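/- Lemma B.5 (high-probability bound on the deviation term for linear bandits): With probability at least 1 − δ, Σ_{t=1}^T (⟨w̃⁺_t, ℓ⁺_t⟩ − ⟨w⁺_t, ℓ̂⁺_t⟩ + ⟨u⁺, ℓ̂⁺_t − ℓ⁺_t⟩) ≤ 161·C·d·√((ν + ρ²)·L̊_T·ln(C/δ)) + C·√(32·L̄_u·ln(C/δ)) + 64·C·d·(√ν + ρ)·ln(C/δ), where C = ⌈log₂ b⌉·⌈log₂(b²T)⌉ = Θ(ln²(dνT)) with b = 2×10⁶·d·ν²·T. -/

import Mathlib

open MeasureTheory Real Finset Matrix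

/-! Common notions for the linear-bandit setting (self-concordant barriers,
the lifted normal barrier, quadratic norms, Bregman divergences, Minkowsky functions). -/

/-- Euclidean dot product on `ℝ^n`. -/
noncomputable def dotp {n : ℕ} (x y : Fin n → ℝ) : ℝ := ∑ i, x i * y i

/-- Quadratic norm `‖h‖_M = √(hᵀ M h)`. -/
noncomputable def qnorm {n : ℕ} (M : Matrix (Fin n) (Fin n) ℝ) (h : Fin n → ℝ) : ℝ :=
  Real.sqrt (dotp h (M.mulVec h))

/-- First directional derivative `Df(x)[h]`. -/
noncomputable def der1 {n : ℕ} (f : (Fin n → ℝ) → ℝ) (x h : Fin n → ℝ) : ℝ :=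
  fderiv ℝ f x h

/-- Second directional derivative `D²f(x)[h₁,h₂]`. -/
noncomputable def der2 {n : ℕ} (f : (Fin n → ℝ) → ℝ) (x h₁ h₂ : Fin n → ℝ) : ℝ :=
  iteratedFDeriv ℝ 2 f x ![h₁, h₂]

/-- Third directional derivative `D³f(x)[h,h,h]`. -/
noncomputable def der3 {n : ℕ} (f : (Fin n → ℝ) → ℝ) (x h : Fin n → ℝ) : ℝ :=
  iteratedFDeriv ℝ 3 f x ![h, h, h]

/-- Hessian matrix `∇²f(x)`. -/
noncomputable def hess {n : ℕ} (f : (Fin n → ℝ) → ℝ) (x : Fin n → ℝ) :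
    Matrix (Fin n) (Fin n) ℝ :=
  Matrix.of fun i j => der2 f x (Pi.single i 1) (Pi.single j 1)

/-- Gradient vector `∇f(x)`. -/
noncomputable def gradv {n : ℕ} (f : (Fin n → ℝ) → ℝ) (x : Fin n → ℝ) : Fin n → ℝ :=
  fun i => fderiv ℝ f x (Pi.single i 1)

/-- Bregman divergence `D_f(u,w) = f(u) − f(w) − ⟨∇f(w), u − w⟩`. -/
noncomputable def breg {n : ℕ} (f : (Fin n → ℝ) → ℝ) (u w : Fin n → ℝ) : ℝ :=
  f u - f w - dotp (gradv f w) (u - w)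

/-- `ψ` is a `ν`-self-concordant barrier for `K`. -/
structure IsSCB {n : ℕ} (K : Set (Fin n → ℝ)) (ψ : (Fin n → ℝ) → ℝ) (ν : ℝ) : Prop where
  smooth : ContDiffOn ℝ 3 ψ (interior K)
  convexOn : ConvexOn ℝ (interior K) ψ
  blowup : ∀ x ∈ frontier K, Filter.Tendsto ψ (nhdsWithin x (interior K)) Filter.atTop
  selfConc : ∀ w ∈ interior K, ∀ h, |der3 ψ w h| ≤ 2 * Real.sqrt (der2 ψ w h h) ^ 3
  gradBound : ∀ w ∈ interior K, ∀ h,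
    |der1 ψ w h| ≤ Real.sqrt ν * Real.sqrt (der2 ψ w h h)

/-- Lift `w ∈ ℝ^d` to `(w,1) ∈ ℝ^{d+1}`. -/
noncomputable def liftv {d : ℕ} (w : Fin d → ℝ) : Fin (d + 1) → ℝ := Fin.snoc w 1

/-- The lifted barrier `Ψ(w,b) = 400 (ψ(w/b) − 2ν ln b)`, an `800ν`-normal barrier on
the conic hull of `Ω⁺`. -/
noncomputable def liftedBarrier {d : ℕ} (ψ : (Fin d → ℝ) → ℝ) (ν : ℝ) :
    (Fin (d + 1) → ℝ) → ℝ :=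
  fun x => 400 * (ψ (fun i => x i.castSucc / x (Fin.last d)) -
    2 * ν * Real.log (x (Fin.last d)))

/-- Minkowsky function `π_w(u) = inf {s > 0 : w + (u − w)/s ∈ K}`. -/
noncomputable def mink {n : ℕ} (K : Set (Fin n → ℝ)) (w u : Fin n → ℝ) : ℝ :=
  sInf {s : ℝ | 0 < s ∧ w + s⁻¹ • (u - w) ∈ K}



theorem aux_condExp_int {Ω : Type*} {m0 : MeasurableSpace Ω} (μ : Measure Ω) [IsProbabilityMeasure μ]
    (m : MeasurableSpace Ω) (hm : m ≤ m0) (G Y y : Ω → ℝ) (hG : StronglyMeasurable[m] G)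
    (K : ℝ) (hGb : ∀ ω, |G ω| ≤ K) (hY : Integrable Y μ) (hy : μ[Y|m] =ᵐ[μ] y) :
    ∫ ω, G ω * Y ω ∂μ = ∫ ω, G ω * y ω ∂μ := by
  have h1 := condExp_stronglyMeasurable_mul_of_bound (μ := μ) hm hG hY K
    (Filter.Eventually.of_forall (by simpa using hGb))
  have h2 : ∫ ω, (μ[G * Y|m]) ω ∂μ = ∫ ω, (G * Y) ω ∂μ := integral_condExp hm
  calc ∫ ω, G ω * Y ω ∂μ = ∫ ω, (μ[G * Y|m]) ω ∂μ := h2.symm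
    _ = _ := by
      apply integral_congr_ae
      filter_upwards [h1, hy] with ω h1 h2
      rw [h1, Pi.mul_apply, h2]

theorem aux_int_bdd {Ω : Type*} {m0 : MeasurableSpace Ω} (μ : Measure Ω) [IsProbabilityMeasure μ]
    (f : Ω → ℝ) (hf : Measurable f) (K : ℝ) (hK : ∀ ω, |f ω| ≤ K) : Integrable f μ :=
  Integrable.of_bound hf.aestronglyMeasurable K (Filter.Eventually.of_forall (by simpa using hK))

theorem aux_exp_le (x : ℝ) (hx : |x| ≤ 1) : Real.exp x ≤ 1 + x + x ^ 2 := by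
  have := Real.abs_exp_sub_one_sub_id_le hx
  have := (abs_le.mp this).2
  linarith

/-- one step -/
theorem aux_step {Ω : Type*} (m : MeasurableSpace Ω) {m0 : MeasurableSpace Ω} (μ : Measure Ω)
    [IsProbabilityMeasure μ] (hm : m ≤ m0) (W Y a y v : Ω → ℝ) (l : ℝ) (hl : |l| ≤ 1)
    (hW : Measurable[m] W) (hW0 : ∀ ω, 0 ≤ W ω) (K : ℝ) (hWK : ∀ ω, W ω ≤ K)
    (hY : Measurable Y) (hYb : ∀ ω, |Y ω| ≤ 1) (ha : Measurable a) (hab : ∀ ω, |a ω| ≤ 1)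
    (hYa : ∀ ω, Y ω ^ 2 ≤ a ω) (hym : Measurable[m] y) (hyb : ∀ ω, |y ω| ≤ 1)
    (hvm : Measurable[m] v) (hvb : ∀ ω, |v ω| ≤ 1)
    (hy : μ[Y|m] =ᵐ[μ] y) (hv : μ[a|m] =ᵐ[μ] v) :
    ∫ ω, W ω * Real.exp (l * (Y ω - y ω) - l ^ 2 * v ω) ∂μ ≤ ∫ ω, W ω ∂μ := by
  set G : Ω → ℝ := fun ω => W ω * Real.exp (-(l * y ω) - l ^ 2 * v ω) with hGdef
  have hGm : Measurable[m] G := hW.mul (by fun_prop)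
  have hG0 : ∀ ω, 0 ≤ G ω := fun ω => mul_nonneg (hW0 ω) (Real.exp_pos _).le
  have hl2 : l ^ 2 ≤ 1 := by rw [← sq_abs]; nlinarith [abs_nonneg l]
  have hK0 : ∀ ω : Ω, 0 ≤ K := fun ω => (hW0 ω).trans (hWK ω)
  have hly : ∀ ω, |l * y ω| ≤ 1 := fun ω => by
    rw [abs_mul]; nlinarith [abs_nonneg l, abs_nonneg (y ω), hyb ω]
  have hlv : ∀ ω, |l ^ 2 * v ω| ≤ 1 := fun ω => by
    rw [abs_mul, abs_of_nonneg (sq_nonneg l)]; nlinarith [sq_nonneg l, abs_nonneg (v ω), hvb ω]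
  have hlY : ∀ ω, |l * Y ω| ≤ 1 := fun ω => by
    rw [abs_mul]; nlinarith [abs_nonneg l, abs_nonneg (Y ω), hYb ω]
  have hGK : ∀ ω, |G ω| ≤ K * Real.exp 2 := fun ω => by
    rw [abs_of_nonneg (hG0 ω)]
    refine mul_le_mul (hWK ω) (Real.exp_le_exp.mpr ?_) (Real.exp_pos _).le (hK0 ω)
    have := abs_le.mp (hly ω); have := abs_le.mp (hlv ω); linarith
  have hGm0 : Measurable G := hGm.mono hm le_rfl
  have hy0 : Measurable y := hym.mono hm le_rfl
  have hv0 : Measurable v := hvm.mono hm le_rfl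
  have hYi : Integrable Y μ := aux_int_bdd μ Y hY 1 hYb
  have hai : Integrable a μ := aux_int_bdd μ a ha 1 hab
  have hbd : ∀ f : Ω → ℝ, Measurable f → (∀ ω, |f ω| ≤ 1) → Integrable (fun ω => G ω * f ω) μ := by
    intro f hf hfb
    refine aux_int_bdd μ _ (hGm0.mul hf) (K * Real.exp 2) fun ω => ?_
    rw [abs_mul]
    nlinarith [abs_nonneg (G ω), abs_nonneg (f ω), hfb ω, hGK ω]
  have hGi : Integrable G μ := aux_int_bdd μ G hGm0 _ hGK
  have e1 := aux_condExp_int μ m hm G Y y hGm.stronglyMeasurable _ hGK hYi hy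
  have e2 := aux_condExp_int μ m hm G a v hGm.stronglyMeasurable _ hGK hai hv
  have iY := hbd Y hY hYb
  have ia := hbd a ha hab
  have iy := hbd y hy0 hyb
  have iv := hbd v hv0 hvb
  have hWi : Integrable W μ := aux_int_bdd μ W (hW.mono hm le_rfl) K fun ω => by
    rw [abs_of_nonneg (hW0 ω)]; exact hWK ω
  calc ∫ ω, W ω * Real.exp (l * (Y ω - y ω) - l ^ 2 * v ω) ∂μ
      ≤ ∫ ω, (G ω + l * (G ω * Y ω) + l ^ 2 * (G ω * a ω)) ∂μ := by
        apply integral_mono_of_nonneg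
        · exact Filter.Eventually.of_forall fun ω => mul_nonneg (hW0 ω) (Real.exp_pos _).le
        · exact (hGi.add (iY.const_mul l)).add (ia.const_mul (l ^ 2))
        · refine Filter.Eventually.of_forall fun ω => ?_
          have h1 : W ω * Real.exp (l * (Y ω - y ω) - l ^ 2 * v ω) = G ω * Real.exp (l * Y ω) := by
            simp only [hGdef]; rw [mul_assoc, ← Real.exp_add]; congr 2; ring
          have h2 := aux_exp_le _ (hlY ω)
          have h3 : l ^ 2 * Y ω ^ 2 ≤ l ^ 2 * a ω := mul_le_mul_of_nonneg_left (hYa ω) (sq_nonneg l)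
          simp only [h1]
          calc G ω * Real.exp (l * Y ω) ≤ G ω * (1 + l * Y ω + l ^ 2 * a ω) := by
                apply mul_le_mul_of_nonneg_left _ (hG0 ω); nlinarith
            _ = _ := by ring
    _ = ∫ ω, (G ω + l * (G ω * y ω) + l ^ 2 * (G ω * v ω)) ∂μ := by
        have key : ∀ p q : Ω → ℝ, Integrable p μ → Integrable q μ →
            ∫ ω, (G ω + l * p ω + l ^ 2 * q ω) ∂μ =
              ∫ ω, G ω ∂μ + l * ∫ ω, p ω ∂μ + l ^ 2 * ∫ ω, q ω ∂μ := by
          intro p q hp hq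
          have h1 : Integrable (fun ω => G ω + l * p ω) μ := hGi.add (hp.const_mul l)
          rw [integral_add h1 (hq.const_mul _), integral_add hGi (hp.const_mul _),
            integral_const_mul, integral_const_mul]
        rw [key _ _ iY ia, key _ _ iy iv, e1, e2]
    _ ≤ ∫ ω, W ω ∂μ := by
        apply integral_mono ((hGi.add (iy.const_mul l)).add (iv.const_mul (l ^ 2))) hWi
        intro ω
        have h1 : W ω = G ω * Real.exp (l * y ω + l ^ 2 * v ω) := by
          simp only [hGdef]; rw [mul_assoc, ← Real.exp_add]; simp
        have h2 := Real.add_one_le_exp (l * y ω + l ^ 2 * v ω)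
        calc G ω + l * (G ω * y ω) + l ^ 2 * (G ω * v ω) = G ω * (l * y ω + l ^ 2 * v ω + 1) := by ring
          _ ≤ G ω * Real.exp (l * y ω + l ^ 2 * v ω) := mul_le_mul_of_nonneg_left h2 (hG0 ω)
          _ = W ω := h1.symm

theorem aux_super {Ω : Type*} {m0 : MeasurableSpace Ω} (μ : Measure Ω) [IsProbabilityMeasure μ]
    (F : ℕ → MeasurableSpace Ω) (hFmono : Monotone F) (hFle : ∀ t, F t ≤ m0) (T : ℕ)
    (Y a y v : ℕ → Ω → ℝ) (l : ℝ) (hl : |l| ≤ 1)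
    (hY : ∀ t ∈ Finset.Icc 1 T, Measurable[F (t+1)] (Y t))
    (hYb : ∀ t ∈ Finset.Icc 1 T, ∀ ω, |Y t ω| ≤ 1)
    (ha : ∀ t ∈ Finset.Icc 1 T, Measurable (a t)) (hab : ∀ t ∈ Finset.Icc 1 T, ∀ ω, |a t ω| ≤ 1)
    (hYa : ∀ t ∈ Finset.Icc 1 T, ∀ ω, Y t ω ^ 2 ≤ a t ω)
    (hym : ∀ t ∈ Finset.Icc 1 T, Measurable[F t] (y t))
    (hyb : ∀ t ∈ Finset.Icc 1 T, ∀ ω, |y t ω| ≤ 1)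
    (hvm : ∀ t ∈ Finset.Icc 1 T, Measurable[F t] (v t))
    (hvb : ∀ t ∈ Finset.Icc 1 T, ∀ ω, |v t ω| ≤ 1)
    (hy : ∀ t ∈ Finset.Icc 1 T, μ[Y t|F t] =ᵐ[μ] y t)
    (hv : ∀ t ∈ Finset.Icc 1 T, μ[a t|F t] =ᵐ[μ] v t) (n : ℕ) (hn : n ≤ T) :
    Measurable[F (n+1)] (fun ω => ∑ t ∈ Finset.Icc 1 n, (l * (Y t ω - y t ω) - l ^ 2 * v t ω)) ∧
    (∀ ω, ∑ t ∈ Finset.Icc 1 n, (l * (Y t ω - y t ω) - l ^ 2 * v t ω) ≤ 3 * n) ∧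
    ∫ ω, Real.exp (∑ t ∈ Finset.Icc 1 n, (l * (Y t ω - y t ω) - l ^ 2 * v t ω)) ∂μ ≤ 1 := by
  induction n with
  | zero => simp
  | succ n ih =>
    obtain ⟨h1, h2, h3⟩ := ih (by omega)
    have hmem : n + 1 ∈ Finset.Icc 1 T := by simp; omega
    have hsum : ∀ ω, ∑ t ∈ Finset.Icc 1 (n+1), (l * (Y t ω - y t ω) - l ^ 2 * v t ω)
      = ∑ t ∈ Finset.Icc 1 n, (l * (Y t ω - y t ω) - l ^ 2 * v t ω) +
        (l * (Y (n+1) ω - y (n+1) ω) - l ^ 2 * v (n+1) ω) := fun ω =>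
      Finset.sum_Icc_succ_top (by omega) _
    simp only [hsum]
    have hle : F (n+1) ≤ F (n+1+1) := hFmono (by omega)
    refine ⟨?_, ?_, ?_⟩
    · have e1 := hY _ hmem
      have e2 := (hym _ hmem).mono hle le_rfl
      have e3 := (hvm _ hmem).mono hle le_rfl
      have e4 := h1.mono hle le_rfl
      fun_prop
    · intro ω
      have := h2 ω
      have hl2 : l ^ 2 ≤ 1 := by rw [← sq_abs]; nlinarith [abs_nonneg l]
      have hly : |l * y (n+1) ω| ≤ 1 := by
        rw [abs_mul]; nlinarith [abs_nonneg l, abs_nonneg (y (n+1) ω), hyb _ hmem ω]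
      have hlv : |l ^ 2 * v (n+1) ω| ≤ 1 := by
        rw [abs_mul, abs_of_nonneg (sq_nonneg l)]
        nlinarith [sq_nonneg l, abs_nonneg (v (n+1) ω), hvb _ hmem ω]
      have hlY : |l * Y (n+1) ω| ≤ 1 := by
        rw [abs_mul]; nlinarith [abs_nonneg l, abs_nonneg (Y (n+1) ω), hYb _ hmem ω]
      have := abs_le.mp hly
      have := abs_le.mp hlv
      have := abs_le.mp hlY
      push_cast
      linarith
    · simp only [Real.exp_add]
      refine le_trans (aux_step (F (n+1)) μ (hFle _) _ (Y (n+1)) (a (n+1)) (y (n+1)) (v (n+1)) l hl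
        (Real.measurable_exp.comp h1) (fun ω => (Real.exp_pos _).le) (Real.exp (3 * n))
        (fun ω => Real.exp_le_exp.mpr (h2 ω)) ((hY _ hmem).mono (hFle _) le_rfl) (hYb _ hmem)
        (ha _ hmem) (hab _ hmem) (hYa _ hmem) (hym _ hmem) (hyb _ hmem) (hvm _ hmem) (hvb _ hmem)
        (hy _ hmem) (hv _ hmem)) h3

theorem aux_tail {Ω : Type*} {m0 : MeasurableSpace Ω} (μ : Measure Ω) [IsProbabilityMeasure μ]
    (f : Ω → ℝ) (hf : Measurable f) (K : ℝ) (hK : ∀ ω, f ω ≤ K)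
    (h : ∫ ω, Real.exp (f ω) ∂μ ≤ 1) (L : ℝ) :
    μ {ω | L < f ω} ≤ ENNReal.ofReal (Real.exp (-L)) := by
  have hi : Integrable (fun ω => Real.exp (f ω)) μ := aux_int_bdd μ _ (by fun_prop) (Real.exp K)
    fun ω => by rw [abs_of_pos (Real.exp_pos _)]; exact Real.exp_le_exp.mpr (hK ω)
  have h1 := mul_meas_ge_le_integral_of_nonneg (μ := μ) (f := fun ω => Real.exp (f ω))
    (Filter.Eventually.of_forall fun ω => (Real.exp_pos _).le) hi (Real.exp L)
  have h2 : μ {ω | L < f ω} ≤ μ {ω | Real.exp L ≤ Real.exp (f ω)} := by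
    apply measure_mono
    intro ω hω
    exact Real.exp_le_exp.mpr (le_of_lt hω)
  refine h2.trans ?_
  rw [← ofReal_measureReal]
  apply ENNReal.ofReal_le_ofReal
  rw [Real.exp_neg, ← one_div, le_div_iff₀ (Real.exp_pos _)]
  linarith


theorem aux_opt (T : ℕ) (V L : ℝ) (hV : 0 ≤ V) (hVT : V ≤ T) (hL : 1 ≤ L) :
    ∃ k ∈ Finset.range (T + 1), V / (k + 1) + (k + 1) * L ≤ 2 * Real.sqrt (V * L) + L := by
  set r := Real.sqrt (V / L) with hr
  have hr0 : 0 ≤ r := Real.sqrt_nonneg _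
  have hL0 : (0:ℝ) < L := by linarith
  have hr2 : r ^ 2 = V / L := Real.sq_sqrt (by positivity)
  have hVr : V = r ^ 2 * L := by rw [hr2]; field_simp
  have hsq : Real.sqrt (V * L) = r * L := by
    rw [hVr, show r ^ 2 * L * L = (r * L) ^ 2 by ring, Real.sqrt_sq (by positivity)]
  refine ⟨⌊r⌋₊, ?_, ?_⟩
  · rw [Finset.mem_range, Nat.lt_succ_iff]
    apply Nat.floor_le_of_le
    have : r ^ 2 ≤ T := by rw [hr2]; exact (div_le_self hV hL).trans hVT
    by_contra hc
    push Not at hc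
    rcases Nat.eq_zero_or_pos T with h | h
    · subst h; simp at *; nlinarith
    · have : (1:ℝ) ≤ T := by exact_mod_cast h
      nlinarith
  · have h1 := Nat.floor_le hr0
    have h2 := Nat.lt_floor_add_one r
    have h3 : V / ((⌊r⌋₊:ℝ) + 1) ≤ r * L := by
      rw [div_le_iff₀ (by positivity), hVr]
      have : r * L * r ≤ r * L * (⌊r⌋₊ + 1) := mul_le_mul_of_nonneg_left h2.le (by positivity)
      nlinarith
    rw [hsq]
    have : (⌊r⌋₊:ℝ) * L ≤ r * L := mul_le_mul_of_nonneg_right h1 hL0.le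
    linarith

theorem aux_conc {Ω : Type*} {m0 : MeasurableSpace Ω} (μ : Measure Ω) [IsProbabilityMeasure μ]
    (F : ℕ → MeasurableSpace Ω) (hFmono : Monotone F) (hFle : ∀ t, F t ≤ m0) (T : ℕ) (hT : 2 ≤ T)
    (δ : ℝ) (hδ : δ ∈ Set.Ioo (0 : ℝ) 1)
    (Y a y v : ℕ → Ω → ℝ)
    (hY : ∀ t ∈ Finset.Icc 1 T, Measurable[F (t+1)] (Y t))
    (hYb : ∀ t ∈ Finset.Icc 1 T, ∀ ω, |Y t ω| ≤ 1)
    (ha : ∀ t ∈ Finset.Icc 1 T, Measurable (a t)) (hab : ∀ t ∈ Finset.Icc 1 T, ∀ ω, |a t ω| ≤ 1)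
    (hYa : ∀ t ∈ Finset.Icc 1 T, ∀ ω, Y t ω ^ 2 ≤ a t ω)
    (hym : ∀ t ∈ Finset.Icc 1 T, Measurable[F t] (y t))
    (hyb : ∀ t ∈ Finset.Icc 1 T, ∀ ω, |y t ω| ≤ 1)
    (hvm : ∀ t ∈ Finset.Icc 1 T, Measurable[F t] (v t))
    (hvb : ∀ t ∈ Finset.Icc 1 T, ∀ ω, 0 ≤ v t ω ∧ v t ω ≤ 1)
    (hy : ∀ t ∈ Finset.Icc 1 T, μ[Y t|F t] =ᵐ[μ] y t)
    (hv : ∀ t ∈ Finset.Icc 1 T, μ[a t|F t] =ᵐ[μ] v t) (L : ℝ)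
    (hL : L = Real.log (2 * T * (T + 1) / δ)) :
    μ {ω | ¬ ∀ n ≤ T, |∑ t ∈ Finset.Icc 1 n, (Y t ω - y t ω)| ≤
      2 * Real.sqrt ((∑ t ∈ Finset.Icc 1 T, v t ω) * L) + L} ≤ ENNReal.ofReal δ := by
  have hT' : (2:ℝ) ≤ T := by exact_mod_cast hT
  have hN : (0:ℝ) < 2 * T * (T + 1) := by positivity
  have hL1 : 1 ≤ L := by
    rw [hL, Real.le_log_iff_exp_le (div_pos hN hδ.1), le_div_iff₀ hδ.1]
    have := Real.exp_one_lt_d9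
    have h2 := hδ.2
    have h1 := hδ.1
    nlinarith
  have hexp : Real.exp (-L) = δ / (2 * T * (T + 1)) := by
    rw [Real.exp_neg, hL, Real.exp_log (div_pos hN hδ.1), inv_div]
  let I : Finset (ℕ × ℕ × ℝ) := Finset.Icc 1 T ×ˢ (Finset.range (T+1) ×ˢ ({1, -1} : Finset ℝ))
  let f : ℕ × ℕ × ℝ → Ω → ℝ := fun i ω => ∑ t ∈ Finset.Icc 1 i.1,
    ((i.2.2 / (i.2.1 + 1)) * (Y t ω - y t ω) - (i.2.2 / (i.2.1 + 1)) ^ 2 * v t ω)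
  have hI : ∀ i ∈ I, μ {ω | L < f i ω} ≤ ENNReal.ofReal (δ / (2 * T * (T + 1))) := by
    rintro ⟨n, k, σ⟩ hi
    simp only [I, Finset.mem_product, Finset.mem_Icc, Finset.mem_range, Finset.mem_insert,
      Finset.mem_singleton] at hi
    have hσ : |σ| = 1 := by rcases hi.2.2 with h | h <;> simp [h]
    have hl : |σ / ((k:ℝ) + 1)| ≤ 1 := by
      rw [abs_div, hσ, abs_of_pos (by positivity)]
      rw [div_le_one (by positivity)]; linarith [(Nat.cast_nonneg k : (0:ℝ) ≤ k)]
    obtain ⟨h1, h2, h3⟩ := aux_super μ F hFmono hFle T Y a y v (σ / ((k:ℝ)+1)) hl hY hYb ha hab hYa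
      hym hyb hvm (fun t ht ω => by rw [abs_of_nonneg (hvb t ht ω).1]; exact (hvb t ht ω).2) hy hv
      n hi.1.2
    have := aux_tail μ _ (h1.mono (hFle _) le_rfl) _ h2 h3 L
    rwa [hexp] at this
  have hsub : {ω | ¬ ∀ n ≤ T, |∑ t ∈ Finset.Icc 1 n, (Y t ω - y t ω)| ≤
      2 * Real.sqrt ((∑ t ∈ Finset.Icc 1 T, v t ω) * L) + L} ⊆ ⋃ i ∈ I, {ω | L < f i ω} := by
    intro ω hω
    by_contra hc
    apply hω
    simp only [Set.mem_iUnion, not_exists, Set.mem_setOf_eq, not_lt] at hc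
    intro n hn
    rcases Nat.eq_zero_or_pos n with h0 | h0
    · subst h0; simp; positivity
    set V := ∑ t ∈ Finset.Icc 1 T, v t ω with hVdef
    have hV0 : 0 ≤ V := Finset.sum_nonneg fun t ht => (hvb t ht ω).1
    have hVT : V ≤ T := by
      calc V ≤ ∑ t ∈ Finset.Icc 1 T, (1:ℝ) := Finset.sum_le_sum fun t ht => (hvb t ht ω).2
        _ = T := by simp
    obtain ⟨k, hk, hkb⟩ := aux_opt T V L hV0 hVT hL1
    have hVn : ∑ t ∈ Finset.Icc 1 n, v t ω ≤ V :=
      Finset.sum_le_sum_of_subset_of_nonneg (Finset.Icc_subset_Icc_right hn)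
        fun t ht _ => (hvb t ht ω).1
    have hk1 : (0:ℝ) < (k:ℝ) + 1 := by positivity
    have key : ∀ σ ∈ ({1, -1} : Finset ℝ), σ * ∑ t ∈ Finset.Icc 1 n, (Y t ω - y t ω) ≤
        2 * Real.sqrt (V * L) + L := by
      intro σ hσ
      have h := hc (n, k, σ) (by
        simp only [I, Finset.mem_product]
        exact ⟨Finset.mem_Icc.mpr ⟨h0, hn⟩, hk, hσ⟩)
      simp only [f] at h
      rw [Finset.sum_sub_distrib, ← Finset.mul_sum, ← Finset.mul_sum] at h
      have hσ2 : σ ^ 2 = 1 := by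
        simp at hσ; rcases hσ with h | h <;> simp [h]
      rw [div_pow, hσ2] at h
      refine le_trans ?_ hkb
      set Sm := ∑ t ∈ Finset.Icc 1 n, (Y t ω - y t ω)
      have h5 : σ * Sm ≤ (∑ t ∈ Finset.Icc 1 n, v t ω) / (k+1) + (k+1) * L := by
        have h6 := mul_le_mul_of_nonneg_left h hk1.le
        have e : ((k:ℝ)+1) * (σ / (k+1) * Sm - 1 / (k+1)^2 * ∑ t ∈ Finset.Icc 1 n, v t ω)
          = σ * Sm - (∑ t ∈ Finset.Icc 1 n, v t ω) / (k+1) := by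
          field_simp
        rw [e] at h6
        linarith
      have h7 : (∑ t ∈ Finset.Icc 1 n, v t ω) / ((k:ℝ)+1) ≤ V / (k+1) :=
        div_le_div_of_nonneg_right hVn hk1.le
      linarith
    rw [abs_le]
    have k1 := key 1 (by simp)
    have k2 := key (-1) (by simp)
    constructor <;> linarith
  refine (measure_mono hsub).trans ((measure_biUnion_finset_le _ _).trans ?_)
  refine (Finset.sum_le_sum hI).trans ?_
  rw [Finset.sum_const, ← ENNReal.ofReal_nsmul]
  apply ENNReal.ofReal_le_ofReal
  have hcard : I.card = T * ((T+1) * 2) := by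
    simp only [I, Finset.card_product, Nat.card_Icc, Finset.card_range]
    rw [Finset.card_pair (by norm_num)]; simp
  rw [hcard, nsmul_eq_mul]
  push_cast
  apply le_of_eq
  field_simp

theorem aux_abel (T : ℕ) (M z : ℕ → ℝ) (B : ℝ) (hM0 : ∀ t, 0 ≤ M t) (hM : ∀ t, M t ≤ M (t+1))
    (hB : ∀ n ≤ T, |∑ t ∈ Finset.Icc 1 n, z t| ≤ B) :
    ∑ t ∈ Finset.Icc 1 T, M t * z t ≤ 2 * M T * B := by
  have key : ∀ n ≤ T, ∑ t ∈ Finset.Icc 1 n, M t * z t - M n * ∑ t ∈ Finset.Icc 1 n, z t ≤ M n * B := by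
    intro n
    induction n with
    | zero =>
      intro _
      have := hB 0 (by omega)
      simp at this ⊢
      exact mul_nonneg (hM0 0) this
    | succ n ih =>
      intro hn
      have h1 := ih (by omega)
      have h2 := abs_le.mp (hB n (by omega))
      rw [Finset.sum_Icc_succ_top (by omega), Finset.sum_Icc_succ_top (by omega)]
      nlinarith [hM n]
  have h1 := key T le_rfl
  have h2 := abs_le.mp (hB T le_rfl)
  nlinarith [hM0 T]


theorem aux_dot_nonneg {n : ℕ} (v : Fin n → ℝ) : 0 ≤ v ⬝ᵥ v :=
  Finset.sum_nonneg fun i _ => mul_self_nonneg (v i)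

theorem aux_hh_mulVec {n : ℕ} (v x : Fin n → ℝ) :
    (1 - (2 / (v ⬝ᵥ v)) • vecMulVec v v : Matrix (Fin n) (Fin n) ℝ).mulVec x
      = x - (2 * (v ⬝ᵥ x) / (v ⬝ᵥ v)) • v := by
  rw [sub_mulVec, one_mulVec, smul_mulVec, vecMulVec_mulVec]
  ext i
  simp
  ring

theorem aux_hh_orth {n : ℕ} (v : Fin n → ℝ) (hv : v ⬝ᵥ v ≠ 0) :
    (1 - (2 / (v ⬝ᵥ v)) • vecMulVec v v : Matrix (Fin n) (Fin n) ℝ)ᵀ *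
    (1 - (2 / (v ⬝ᵥ v)) • vecMulVec v v : Matrix (Fin n) (Fin n) ℝ) = 1 := by
  have h1 : (1 - (2 / (v ⬝ᵥ v)) • vecMulVec v v : Matrix (Fin n) (Fin n) ℝ)ᵀ
    = 1 - (2 / (v ⬝ᵥ v)) • vecMulVec v v := by
    simp [transpose_sub, transpose_smul, transpose_vecMulVec]
  rw [h1]
  have h2 : vecMulVec v v * vecMulVec v v = (v ⬝ᵥ v) • vecMulVec v v := by
    rw [vecMulVec_mul_vecMulVec]
    ext i j; simp [vecMulVec_apply]; ring
  rw [sub_mul, mul_sub, mul_sub, smul_mul_smul_comm, h2, smul_smul]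
  simp only [one_mul, mul_one]
  have : (2 / (v ⬝ᵥ v)) * (2 / (v ⬝ᵥ v)) * (v ⬝ᵥ v) = 2 / (v ⬝ᵥ v) + 2 / (v ⬝ᵥ v) := by
    field_simp; ring
  rw [this, add_smul]
  abel

section
variable {d : ℕ} (κ : Measure (Fin (d+1) → ℝ)) [IsProbabilityMeasure κ] (nv : Fin (d+1) → ℝ)

theorem aux_inv
    (hunif : ∀ O : Matrix (Fin (d + 1)) (Fin (d + 1)) ℝ, Oᵀ * O = 1 →
        O.mulVec nv = nv → κ.map O.mulVec = κ)
    (v : Fin (d+1) → ℝ) (hv : v ⬝ᵥ v ≠ 0) (hvn : v ⬝ᵥ nv = 0)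
    (g : (Fin (d+1) → ℝ) → ℝ) (hg : Measurable g) :
    ∫ x, g (x - (2 * (v ⬝ᵥ x) / (v ⬝ᵥ v)) • v) ∂κ = ∫ x, g x ∂κ := by
  have h := hunif _ (aux_hh_orth v hv) (by rw [aux_hh_mulVec, hvn]; simp)
  have hm : Measurable (1 - (2 / (v ⬝ᵥ v)) • vecMulVec v v : Matrix (Fin (d+1)) (Fin (d+1)) ℝ).mulVec := by
    have : Continuous (1 - (2 / (v ⬝ᵥ v)) • vecMulVec v v : Matrix (Fin (d+1)) (Fin (d+1)) ℝ).mulVec := by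
      fun_prop
    exact this.measurable
  conv_rhs => rw [← h]
  rw [integral_map hm.aemeasurable hg.aestronglyMeasurable]
  simp only [aux_hh_mulVec]

theorem aux_moment1
    (hunif : ∀ O : Matrix (Fin (d + 1)) (Fin (d + 1)) ℝ, Oᵀ * O = 1 →
        O.mulVec nv = nv → κ.map O.mulVec = κ)
    (v : Fin (d+1) → ℝ) (hvn : v ⬝ᵥ nv = 0) : ∫ x, v ⬝ᵥ x ∂κ = 0 := by
  by_cases hv : v ⬝ᵥ v = 0
  · rw [dotProduct_self_eq_zero] at hv; simp [hv]
  have h := aux_inv κ nv hunif v hv hvn (fun x => v ⬝ᵥ x) (by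
    have : Continuous (fun x : Fin (d+1) → ℝ => v ⬝ᵥ x) := by fun_prop
    exact this.measurable)
  have e : ∀ x, v ⬝ᵥ (x - (2 * (v ⬝ᵥ x) / (v ⬝ᵥ v)) • v) = - (v ⬝ᵥ x) := by
    intro x; rw [dotProduct_sub, dotProduct_smul, smul_eq_mul]; field_simp; ring
  simp only [e, integral_neg] at h
  linarith

theorem aux_moment_eq
    (hunif : ∀ O : Matrix (Fin (d + 1)) (Fin (d + 1)) ℝ, Oᵀ * O = 1 →
        O.mulVec nv = nv → κ.map O.mulVec = κ)
    (v u : Fin (d+1) → ℝ) (hvn : v ⬝ᵥ nv = 0) (hun : u ⬝ᵥ nv = 0) (huv : u ⬝ᵥ u = v ⬝ᵥ v) :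
    ∫ x, (v ⬝ᵥ x) ^ 2 ∂κ = ∫ x, (u ⬝ᵥ x) ^ 2 ∂κ := by
  by_cases hv : (v - u) ⬝ᵥ (v - u) = 0
  · rw [dotProduct_self_eq_zero, sub_eq_zero] at hv; rw [hv]
  have h := aux_inv κ nv hunif (v - u) hv (by rw [sub_dotProduct, hvn, hun, sub_zero])
    (fun x => (v ⬝ᵥ x) ^ 2) (by
    have : Continuous (fun x : Fin (d+1) → ℝ => (v ⬝ᵥ x) ^ 2) := by fun_prop
    exact this.measurable)
  rw [← h]
  congr 1
  ext x
  congr 1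
  have e1 : (v - u) ⬝ᵥ (v - u) = 2 * (v ⬝ᵥ (v - u)) := by
    simp only [sub_dotProduct, dotProduct_sub, huv, dotProduct_comm u v]; ring
  rw [dotProduct_sub, dotProduct_smul, smul_eq_mul]
  rw [e1] at hv ⊢
  have hv' : v ⬝ᵥ (v - u) ≠ 0 := fun h => hv (by rw [h]; simp)
  rw [sub_dotProduct v u x]
  field_simp
  ring

theorem aux_bdd_supp (hsupp : ∀ᵐ x ∂κ, x ⬝ᵥ x = 1 ∧ x ⬝ᵥ nv = 0) (g : (Fin (d+1) → ℝ) → ℝ)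
    (hg : Continuous g) : Integrable g κ := by
  obtain ⟨K, hK⟩ := (isCompact_univ_pi (fun _ : Fin (d+1) => isCompact_Icc (a := (-1:ℝ)) (b := 1))).exists_bound_of_continuousOn
    hg.continuousOn
  refine Integrable.of_bound hg.aestronglyMeasurable K ?_
  filter_upwards [hsupp] with x hx
  apply hK
  intro i _
  have h1 : x i * x i ≤ x ⬝ᵥ x :=
    Finset.single_le_sum (f := fun i => x i * x i) (fun i _ => mul_self_nonneg _) (Finset.mem_univ i)
  rw [hx.1] at h1
  constructor <;> nlinarith

theorem aux_moment_sq (hd : 1 ≤ d) (hnv : nv ⬝ᵥ nv ≠ 0)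
    (hsupp : ∀ᵐ x ∂κ, x ⬝ᵥ x = 1 ∧ x ⬝ᵥ nv = 0)
    (hunif : ∀ O : Matrix (Fin (d + 1)) (Fin (d + 1)) ℝ, Oᵀ * O = 1 →
        O.mulVec nv = nv → κ.map O.mulVec = κ)
    (v : Fin (d+1) → ℝ) (hvn : v ⬝ᵥ nv = 0) :
    ∫ x, (v ⬝ᵥ x) ^ 2 ∂κ = (v ⬝ᵥ v) / d := by
  have hprop : ∀ u : Fin (d+1) → ℝ, u ⬝ᵥ nv = 0 →
      (u ⬝ᵥ u) * ∫ x, (v ⬝ᵥ x) ^ 2 ∂κ = (v ⬝ᵥ v) * ∫ x, (u ⬝ᵥ x) ^ 2 ∂κ := by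
    intro u hu
    have hu0 : 0 ≤ u ⬝ᵥ u := aux_dot_nonneg u
    have hv0 : 0 ≤ v ⬝ᵥ v := aux_dot_nonneg v
    have h := aux_moment_eq κ nv hunif (√(u ⬝ᵥ u) • v) (√(v ⬝ᵥ v) • u)
      (by rw [smul_dotProduct, hvn, smul_zero]) (by rw [smul_dotProduct, hu, smul_zero])
      (by simp only [smul_dotProduct, dotProduct_smul, smul_eq_mul]
          rw [← mul_assoc, ← mul_assoc, Real.mul_self_sqrt hu0, Real.mul_self_sqrt hv0, mul_comm])
    simp only [smul_dotProduct, smul_eq_mul, mul_pow, Real.sq_sqrt hu0, Real.sq_sqrt hv0,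
      integral_const_mul] at h
    exact h
  let p : Fin (d+1) → Fin (d+1) → ℝ := fun i => Pi.single i 1 - (nv i / (nv ⬝ᵥ nv)) • nv
  have hp : ∀ i, p i ⬝ᵥ nv = 0 := by
    intro i
    simp only [p, sub_dotProduct, smul_dotProduct, single_dotProduct, smul_eq_mul]
    field_simp; ring
  have hpp : ∀ i, p i ⬝ᵥ p i = 1 - (nv i * nv i) / (nv ⬝ᵥ nv) := by
    intro i
    have : p i ⬝ᵥ p i = p i ⬝ᵥ Pi.single i 1 := by
      conv_lhs => rw [show p i ⬝ᵥ p i = p i ⬝ᵥ (Pi.single i 1 - (nv i / (nv ⬝ᵥ nv)) • nv) from rfl]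
      rw [dotProduct_sub, dotProduct_smul, hp i]; simp
    rw [this]
    simp [p, sub_dotProduct, dotProduct_single]
    ring
  have hpx : ∀ i, ∫ x, (p i ⬝ᵥ x) ^ 2 ∂κ = ∫ x, x i * x i ∂κ := by
    intro i
    apply integral_congr_ae
    filter_upwards [hsupp] with x hx
    simp only [p, sub_dotProduct, smul_dotProduct, single_dotProduct, dotProduct_comm nv x, hx.2]
    simp [sq]
  have hsum : ∑ i, ∫ x, x i * x i ∂κ = 1 := by
    rw [← integral_finsetSum]
    · have : ∫ x, (1:ℝ) ∂κ = 1 := by simp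
      rw [← this]
      apply integral_congr_ae
      filter_upwards [hsupp] with x hx
      exact hx.1
    · intro i _
      exact aux_bdd_supp κ nv hsupp _ (by fun_prop)
  have htot : (∑ i, p i ⬝ᵥ p i) * ∫ x, (v ⬝ᵥ x) ^ 2 ∂κ = (v ⬝ᵥ v) * 1 := by
    rw [← hsum, Finset.sum_mul, Finset.mul_sum]
    exact Finset.sum_congr rfl fun i _ => by rw [hprop _ (hp i), hpx]
  have hd' : (d:ℝ) ≠ 0 := by positivity
  have htr : ∑ i, p i ⬝ᵥ p i = d := by
    simp only [hpp, Finset.sum_sub_distrib, ← Finset.sum_div]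
    rw [show ∑ i, nv i * nv i = nv ⬝ᵥ nv from rfl, div_self hnv]
    simp
  rw [htr] at htot
  field_simp
  linarith

theorem aux_moment2 (hd : 1 ≤ d) (hnv : nv ⬝ᵥ nv ≠ 0)
    (hsupp : ∀ᵐ x ∂κ, x ⬝ᵥ x = 1 ∧ x ⬝ᵥ nv = 0)
    (hunif : ∀ O : Matrix (Fin (d + 1)) (Fin (d + 1)) ℝ, Oᵀ * O = 1 →
        O.mulVec nv = nv → κ.map O.mulVec = κ)
    (v u : Fin (d+1) → ℝ) (hvn : v ⬝ᵥ nv = 0) (hun : u ⬝ᵥ nv = 0) :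
    ∫ x, (v ⬝ᵥ x) * (u ⬝ᵥ x) ∂κ = (v ⬝ᵥ u) / d := by
  have h1 := aux_moment_sq κ nv hd hnv hsupp hunif (v + u) (by rw [add_dotProduct, hvn, hun, add_zero])
  have h2 := aux_moment_sq κ nv hd hnv hsupp hunif (v - u) (by rw [sub_dotProduct, hvn, hun, sub_zero])
  have e : ∀ x, (v ⬝ᵥ x) * (u ⬝ᵥ x) = (1/4) * (((v + u) ⬝ᵥ x) ^ 2 - ((v - u) ⬝ᵥ x) ^ 2) := by
    intro x; rw [add_dotProduct, sub_dotProduct]; ring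
  simp only [e]
  rw [integral_const_mul, integral_sub (aux_bdd_supp κ nv hsupp _ (by fun_prop))
    (aux_bdd_supp κ nv hsupp _ (by fun_prop)), h1, h2]
  simp only [add_dotProduct, dotProduct_add, sub_dotProduct, dotProduct_sub, dotProduct_comm u v]
  ring
end


open scoped MatrixOrder in
theorem aux_sqrt_unique {n : ℕ} (A B : Matrix (Fin n) (Fin n) ℝ) (hA : A.PosSemidef) (hB : B.PosSemidef)
    (h : A * A = B * B) : A = B := by
  exact (CFC.mul_self_eq_mul_self_iff A B hA.nonneg hB.nonneg).mp h

theorem aux_R_meas {n : ℕ} {Ω : Type*} (m : MeasurableSpace Ω)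
    (R : Ω → Fin n → Fin n → ℝ) (H : Ω → Fin n → Fin n → ℝ)
    (hH : ∀ i j, Measurable fun ω => H ω i j)
    (hR : ∀ ω, (Matrix.of (R ω)).PosDef ∧ Matrix.of (R ω) * Matrix.of (R ω) = Matrix.of (H ω)) :
    ∀ i j, Measurable fun ω => R ω i j := by
  let s : Set (Fin n → Fin n → ℝ) := {A | (Matrix.of A).PosSemidef}
  let f : (Fin n → Fin n → ℝ) → (Fin n → Fin n → ℝ) := fun A i j => ∑ k, A i k * A k j
  have hs : MeasurableSet s := by
    have : s = {A | (∀ i j, A j i = A i j) ∧ ∀ x : Fin n → ℝ, 0 ≤ x ⬝ᵥ (Matrix.of A).mulVec x} := by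
      ext A
      simp only [s, Set.mem_ofPred_eq, posSemidef_iff_dotProduct_mulVec, star_trivial]
      refine and_congr_left fun _ => ?_
      rw [Matrix.IsHermitian.ext_iff]
      simp
    rw [this]
    apply IsClosed.measurableSet
    simp only [Set.ofPred_and, Set.ofPred_forall]
    refine IsClosed.inter (isClosed_iInter fun i => isClosed_iInter fun j =>
      isClosed_eq (by fun_prop) (by fun_prop)) (isClosed_iInter fun x =>
      isClosed_le continuous_const ?_)
    simp only [dotProduct, mulVec, Matrix.of_apply]
    fun_prop
  have hf : Continuous f := by fun_prop
  have hinj : Set.InjOn f s := by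
    intro A hA B hB hAB
    apply aux_sqrt_unique (Matrix.of A) (Matrix.of B) hA hB
    ext i j
    have := congrFun (congrFun hAB i) j
    simpa [Matrix.mul_apply, f] using this
  have hemb := hf.continuousOn.measurableEmbedding hs hinj
  let R' : Ω → s := fun ω => ⟨R ω, (hR ω).1.posSemidef⟩
  have h1 : Measurable (s.domRestrict f ∘ R') := by
    have : s.domRestrict f ∘ R' = H := by
      funext ω i j
      have := congrFun (congrFun (hR ω).2 i) j
      rw [Matrix.mul_apply] at this
      exact this
    rw [this]
    exact measurable_pi_lambda _ fun i => measurable_pi_lambda _ fun j => hH i j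
  have h2 : Measurable R' := hemb.measurable_comp_iff.mp h1
  have h3 : Measurable R := measurable_subtype_coe.comp h2
  intro i j
  exact (measurable_pi_apply j).comp ((measurable_pi_apply i).comp h3)


theorem aux_der2_eq {n : ℕ} (f : (Fin n → ℝ) → ℝ) (x h k : Fin n → ℝ) :
    der2 f x h k = fderiv ℝ (fderiv ℝ f) x h k := by
  simp [der2, iteratedFDeriv_two_apply]

theorem aux_hess_form {n : ℕ} (f : (Fin n → ℝ) → ℝ) (x p q : Fin n → ℝ) :
    dotp p ((hess f x).mulVec q) = der2 f x p q := by
  have hexp : ∀ p : Fin n → ℝ, p = ∑ i, p i • (Pi.single i (1:ℝ) : Fin n → ℝ) := by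
    intro p; ext j; simp [Finset.sum_apply, Pi.single_apply]
  rw [aux_der2_eq]
  conv_rhs => rw [hexp p, hexp q]
  simp only [map_sum, map_smul, _root_.sum_apply, _root_.smul_apply,
    dotp, mulVec, dotProduct, hess, Matrix.of_apply, aux_der2_eq, smul_eq_mul]
  simp only [Finset.mul_sum]
  rw [Finset.sum_comm]
  refine Finset.sum_congr rfl fun i _ => ?_
  refine Finset.sum_congr rfl fun j _ => ?_
  ring

theorem aux_line1 {n : ℕ} (f : (Fin n → ℝ) → ℝ) (x h : Fin n → ℝ) (t : ℝ)
    (hf : DifferentiableAt ℝ f (x + t • h)) :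
    HasDerivAt (fun s : ℝ => f (x + s • h)) (der1 f (x + t • h) h) t := by
  have h1 : HasDerivAt (fun s : ℝ => x + s • h) h t := by
    simpa using ((hasDerivAt_id t).smul_const h).const_add x
  exact hf.hasFDerivAt.comp_hasDerivAt t h1

theorem aux_line2 {n : ℕ} (f : (Fin n → ℝ) → ℝ) (x h : Fin n → ℝ) (t : ℝ)
    (hf : ContDiffAt ℝ 3 f (x + t • h)) :
    HasDerivAt (fun s : ℝ => der2 f (x + s • h) h h) (der3 f (x + t • h) h) t := by
  have h1 : HasDerivAt (fun s : ℝ => x + s • h) h t := by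
    simpa using ((hasDerivAt_id t).smul_const h).const_add x
  have h2 : DifferentiableAt ℝ (iteratedFDeriv ℝ 2 f) (x + t • h) :=
    hf.differentiableAt_iteratedFDeriv (by norm_num)
  have h3 := h2.hasFDerivAt.comp_hasDerivAt t h1
  have h4 := ((ContinuousMultilinearMap.apply ℝ (fun _ : Fin 2 => Fin n → ℝ) ℝ ![h, h]).hasFDerivAt).comp_hasDerivAt t h3
  refine h4.congr_deriv ?_
  simp only [der3]
  rw [iteratedFDeriv_succ_apply_left]
  simp

theorem aux_line3 {n : ℕ} (f : (Fin n → ℝ) → ℝ) (x h : Fin n → ℝ)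
    (hf : ContDiffAt ℝ 2 f x) :
    deriv (deriv (fun s : ℝ => f (x + s • h))) 0 = der2 f x h h := by
  have hc : Filter.Tendsto (fun s : ℝ => x + s • h) (nhds 0) (nhds x) := by
    have : Continuous (fun s : ℝ => x + s • h) := by fun_prop
    simpa using this.tendsto 0
  have hev : ∀ᶠ y in nhds x, DifferentiableAt ℝ f y := by
    filter_upwards [hf.eventually (by simp)] with y hy
    exact hy.differentiableAt (by norm_num)
  have he : deriv (fun s : ℝ => f (x + s • h)) =ᶠ[nhds 0] fun s => fderiv ℝ f (x + s • h) h := by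
    filter_upwards [hc.eventually hev] with s hs
    exact (aux_line1 f x h s hs).deriv
  rw [he.deriv_eq, aux_der2_eq]
  have h1 : HasDerivAt (fun s : ℝ => x + s • h) h 0 := by
    simpa using ((hasDerivAt_id (0:ℝ)).smul_const h).const_add x
  have h2 : DifferentiableAt ℝ (fderiv ℝ f) (x + (0:ℝ) • h) := by
    simpa using (hf.fderiv_right (m := 1) (by norm_num)).differentiableAt (by norm_num)
  have h3 := h2.hasFDerivAt.comp_hasDerivAt (0:ℝ) h1
  have h4 := h3.clm_apply (hasDerivAt_const (0:ℝ) h)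
  have := h4.deriv
  simp at this
  exact this

theorem aux_dikin {n : ℕ} (K : Set (Fin n → ℝ)) (ψ : (Fin n → ℝ) → ℝ) (ν : ℝ)
    (hψ : IsSCB K ψ ν) (x h : Fin n → ℝ) (hx : x ∈ interior K) (hh : der2 ψ x h h ≤ 1 / 400) :
    x + h ∈ interior K := by
  by_contra hcon
  have hc : Continuous (fun s : ℝ => x + s • h) := by fun_prop
  let Z : Set ℝ := Set.Icc 0 1 ∩ {s | x + s • h ∉ interior K}
  have hZc : IsCompact Z := isCompact_Icc.inter_right
    ((isOpen_interior.preimage hc).isClosed_compl)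
  have hZne : Z.Nonempty := ⟨1, by simp [Z, hcon]⟩
  obtain ⟨τ, hτ⟩ := hZc.exists_isLeast hZne
  have hτ01 : τ ∈ Set.Icc (0:ℝ) 1 := hτ.1.1
  have hτn : x + τ • h ∉ interior K := hτ.1.2
  have hτ0 : 0 < τ := by
    rcases hτ01.1.lt_or_eq with h1 | h1
    · exact h1
    · exfalso; apply hτn; rw [← h1]; simpa using hx
  have hin : ∀ s, 0 ≤ s → s < τ → x + s • h ∈ interior K := by
    intro s h0 h1
    by_contra h2
    exact absurd (hτ.2 ⟨⟨h0, h1.le.trans hτ01.2⟩, h2⟩) (not_le.mpr h1)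
  have hcd : ∀ s, 0 ≤ s → s < τ → ContDiffAt ℝ 3 ψ (x + s • h) := fun s h0 h1 =>
    hψ.smooth.contDiffAt (isOpen_interior.mem_nhds (hin s h0 h1))
  have hbound : ∀ s, 0 ≤ s → s < τ → der2 ψ (x + s • h) h h ≤ (1 + s) / 100 := by
    intro s0 h0 h1
    have := image_le_of_deriv_right_lt_deriv_boundary' (f := fun s => der2 ψ (x + s • h) h h)
      (f' := fun s => der3 ψ (x + s • h) h) (a := 0) (b := s0) (B := fun s => (1 + s) / 100)
      (B' := fun _ => 1 / 100)
      (fun s hs => (aux_line2 ψ x h s (hcd s hs.1 (hs.2.trans_lt h1))).continuousAt.continuousWithinAt)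
      (fun s hs => (aux_line2 ψ x h s (hcd s hs.1 (hs.2.trans h1))).hasDerivWithinAt)
      (by simp; linarith) (by fun_prop)
      (fun s hs => by
        have : HasDerivAt (fun s : ℝ => (1 + s) / 100) (1 / 100) s :=
          ((hasDerivAt_id s).const_add 1).div_const 100
        exact this.hasDerivWithinAt)
      (fun s hs he => by
        have h3 := hψ.selfConc _ (hin s hs.1 (hs.2.trans h1)) h
        rw [he] at h3
        have h4 := (abs_le.mp h3).2
        have hs1 : s ≤ 1 := by linarith [hs.2, hτ01.2]
        have h5 : √((1 + s) / 100) ≤ 3 / 20 := by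
          rw [Real.sqrt_le_left (by norm_num)]; linarith
        have h6 : √((1 + s) / 100) ^ 3 ≤ (3 / 20) ^ 3 := pow_le_pow_left₀ (Real.sqrt_nonneg _) h5 3
        linarith)
    exact this ⟨h0, le_rfl⟩
  have hgrad : ∀ s, 0 ≤ s → s < τ → |der1 ψ (x + s • h) h| ≤ √ν := by
    intro s h0 h1
    refine (hψ.gradBound _ (hin s h0 h1) h).trans ?_
    have : √(der2 ψ (x + s • h) h h) ≤ 1 := by
      rw [Real.sqrt_le_left (by norm_num)]
      linarith [hbound s h0 h1, hτ01.2]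
    nlinarith [Real.sqrt_nonneg ν]
  have hval : ∀ s, 0 ≤ s → s < τ → ψ (x + s • h) ≤ ψ x + √ν := by
    intro s0 h0 h1
    have := Convex.norm_image_sub_le_of_norm_hasDerivWithin_le (f := fun s => ψ (x + s • h))
      (f' := fun s => der1 ψ (x + s • h) h) (s := Set.Icc 0 s0) (C := √ν) (x := 0) (y := s0)
      (fun s hs => (aux_line1 ψ x h s ((hcd s hs.1 (hs.2.trans_lt h1)).differentiableAt
        (by norm_num))).hasDerivWithinAt)
      (fun s hs => hgrad s hs.1 (hs.2.trans_lt h1)) (convex_Icc _ _) ⟨le_rfl, h0⟩ ⟨h0, le_rfl⟩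
    simp only [zero_smul, add_zero, sub_zero, Real.norm_eq_abs, abs_of_nonneg h0] at this
    have h2 := (abs_le.mp this).2
    have : √ν * s0 ≤ √ν := by nlinarith [Real.sqrt_nonneg ν, hτ01.2]
    linarith
  have hlim : Filter.Tendsto (fun s : ℝ => x + s • h) (nhdsWithin τ (Set.Ico 0 τ))
      (nhdsWithin (x + τ • h) (interior K)) := by
    apply tendsto_nhdsWithin_of_tendsto_nhds_of_eventually_within
    · exact (hc.tendsto τ).mono_left nhdsWithin_le_nhds
    · filter_upwards [self_mem_nhdsWithin] with s hs
      exact hin s hs.1 hs.2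
  have hne : (nhdsWithin τ (Set.Ico 0 τ)).NeBot := by
    rw [← mem_closure_iff_nhdsWithin_neBot, closure_Ico hτ0.ne]
    exact ⟨hτ0.le, le_rfl⟩
  have hcl : x + τ • h ∈ closure (interior K) :=
    mem_closure_iff_nhdsWithin_neBot.mpr (hlim.neBot)
  have hfr : x + τ • h ∈ frontier K := ⟨closure_mono interior_subset hcl, hτn⟩
  have htop := (hψ.blowup _ hfr).comp hlim
  have := htop.eventually_gt_atTop (ψ x + √ν)
  obtain ⟨s, hs1, hs2⟩ := (this.and self_mem_nhdsWithin).exists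
  exact absurd (hval s hs2.1 hs2.2) (not_le.mpr hs1)


theorem aux_Psi_line_h {d : ℕ} (ψ : (Fin d → ℝ) → ℝ) (ν : ℝ) (w : Fin d → ℝ)
    (h : Fin (d+1) → ℝ) (hh : h (Fin.last d) = 0) (s : ℝ) :
    liftedBarrier ψ ν (liftv w + s • h) = 400 * ψ (w + s • fun i => h i.castSucc) := by
  have : (fun i : Fin d => (liftv w + s • h) i.castSucc / (liftv w + s • h) (Fin.last d)) =
      w + s • fun i => h i.castSucc := by
    funext i; simp [liftv, hh]
  simp only [liftedBarrier]
  rw [this]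
  simp [liftv, hh]

theorem aux_Psi_contDiff {d : ℕ} (K : Set (Fin d → ℝ)) (ψ : (Fin d → ℝ) → ℝ) (ν : ℝ)
    (hψ : IsSCB K ψ ν) (w : Fin d → ℝ) (hw : w ∈ interior K) :
    ContDiffAt ℝ 2 (liftedBarrier ψ ν) (liftv w) := by
  have h1 : ContDiffAt ℝ 2 ψ w :=
    (hψ.smooth.contDiffAt (isOpen_interior.mem_nhds hw)).of_le (by norm_num)
  have hl : liftv w (Fin.last d) ≠ 0 := by simp [liftv]
  have h2 : ContDiffAt ℝ 2 (fun x : Fin (d+1) → ℝ => fun i : Fin d => x i.castSucc / x (Fin.last d))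
      (liftv w) := by
    rw [contDiffAt_pi]
    intro i
    exact ContDiffAt.div (by fun_prop) (by fun_prop) hl
  have e : (fun i : Fin d => liftv w i.castSucc / liftv w (Fin.last d)) = w := by
    funext i; simp [liftv]
  have h3 : ContDiffAt ℝ 2 (fun x : Fin (d+1) → ℝ => ψ (fun i : Fin d => x i.castSucc / x (Fin.last d)))
      (liftv w) := ContDiffAt.comp (liftv w) (g := ψ) (by rw [e]; exact h1) h2
  have h4 : ContDiffAt ℝ 2 (fun x : Fin (d+1) → ℝ => Real.log (x (Fin.last d))) (liftv w) :=
    ContDiffAt.log (by fun_prop) hl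
  unfold liftedBarrier
  exact contDiffAt_const.mul (h3.sub (contDiffAt_const.mul h4))

theorem aux_Psi_der2_h {d : ℕ} (K : Set (Fin d → ℝ)) (ψ : (Fin d → ℝ) → ℝ) (ν : ℝ)
    (hψ : IsSCB K ψ ν) (w : Fin d → ℝ) (hw : w ∈ interior K)
    (h : Fin (d+1) → ℝ) (hh : h (Fin.last d) = 0) :
    der2 (liftedBarrier ψ ν) (liftv w) h h =
      400 * der2 ψ w (fun i => h i.castSucc) (fun i => h i.castSucc) := by
  have h1 : ContDiffAt ℝ 2 ψ w :=
    (hψ.smooth.contDiffAt (isOpen_interior.mem_nhds hw)).of_le (by norm_num)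
  rw [← aux_line3 _ _ _ (aux_Psi_contDiff K ψ ν hψ w hw), ← aux_line3 _ _ _ h1]
  simp only [aux_Psi_line_h ψ ν w h hh]
  have : deriv (fun s : ℝ => 400 * ψ (w + s • fun i => h i.castSucc)) =
    fun s => 400 * deriv (fun s : ℝ => ψ (w + s • fun i => h i.castSucc)) s := by
    funext s; exact deriv_const_mul_field _
  rw [this, deriv_const_mul_field]

theorem aux_Psi_der2_w {d : ℕ} (K : Set (Fin d → ℝ)) (ψ : (Fin d → ℝ) → ℝ) (ν : ℝ)
    (hψ : IsSCB K ψ ν) (w : Fin d → ℝ) (hw : w ∈ interior K) :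
    der2 (liftedBarrier ψ ν) (liftv w) (liftv w) (liftv w) = 800 * ν := by
  rw [← aux_line3 _ _ _ (aux_Psi_contDiff K ψ ν hψ w hw)]
  have hpos : ∀ᶠ s : ℝ in nhds 0, 0 < 1 + s := by
    have : Set.Ioi (-1:ℝ) ∈ nhds (0:ℝ) := Ioi_mem_nhds (by norm_num)
    filter_upwards [this] with s hs
    have : -1 < s := hs
    linarith
  have e1 : ∀ s : ℝ, 0 < 1 + s → liftedBarrier ψ ν (liftv w + s • liftv w) =
      400 * (ψ w - 2 * ν * Real.log (1 + s)) := by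
    intro s hs
    have : (fun i : Fin d => (liftv w + s • liftv w) i.castSucc /
        (liftv w + s • liftv w) (Fin.last d)) = w := by
      funext i
      simp [liftv]
      field_simp
    simp only [liftedBarrier]
    rw [this]
    simp [liftv]
  have e2 : deriv (fun s : ℝ => liftedBarrier ψ ν (liftv w + s • liftv w)) =ᶠ[nhds 0]
      fun s => (-(800 * ν)) * (1 + s)⁻¹ := by
    filter_upwards [hpos.eventually_nhds] with s hs
    have hs' : 0 < 1 + s := hs.self_of_nhds
    have : (fun s : ℝ => liftedBarrier ψ ν (liftv w + s • liftv w)) =ᶠ[nhds s]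
      fun s => 400 * (ψ w - 2 * ν * Real.log (1 + s)) := hs.mono e1
    rw [this.deriv_eq]
    have h1 : HasDerivAt (fun s : ℝ => Real.log (1 + s)) (1 / (1 + s)) s :=
      ((hasDerivAt_id s).const_add 1).log hs'.ne'
    have h2 := ((h1.const_mul (2 * ν)).const_sub (ψ w)).const_mul 400
    rw [h2.deriv]
    field_simp
    ring
  rw [e2.deriv_eq, deriv_const_mul_field]
  have h1 : HasDerivAt (fun s : ℝ => (1 + s)⁻¹) (-1 / (1 + 0) ^ 2) 0 :=
    ((hasDerivAt_id (0:ℝ)).const_add 1).inv (by norm_num)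
  rw [h1.deriv]
  ring

theorem aux_liftv_init {d : ℕ} (X : Fin (d+1) → ℝ) (h : X (Fin.last d) = 1) :
    liftv (fun i : Fin d => X i.castSucc) = X := by
  funext j
  refine Fin.lastCases ?_ (fun i => ?_) j
  · simp [liftv, h]
  · simp [liftv]

theorem aux_boundary {d : ℕ} (K : Set (Fin d → ℝ)) (hconv : Convex ℝ K) (hcl : IsClosed K)
    (hint : (interior K).Nonempty) (ψ : (Fin d → ℝ) → ℝ) (ν : ℝ)
    (hψ : IsSCB K ψ ν) (w : Fin d → ℝ) (hw : w ∈ K) (hwi : w ∉ interior K) :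
    hess (liftedBarrier ψ ν) (liftv w) = 0 := by
  set Ψ := liftedBarrier ψ ν with hΨ
  have hnd : ¬ DifferentiableAt ℝ (fderiv ℝ Ψ) (liftv w) := by
    intro hdiff
    have hcont := hdiff.continuousAt.norm
    have hev : ∀ᶠ X in nhds (liftv w), ‖fderiv ℝ Ψ X‖ < ‖fderiv ℝ Ψ (liftv w)‖ + 1 :=
      hcont.eventually_lt continuousAt_const (by simp)
    obtain ⟨ε, hε, hball⟩ := Metric.eventually_nhds_iff_ball.mp hev
    set C := ‖fderiv ℝ Ψ (liftv w)‖ + 1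
    have hC : 0 ≤ C := by positivity
    let s : Set (Fin (d+1) → ℝ) := Metric.ball (liftv w) ε ∩
      {X | X (Fin.last d) = 1 ∧ (fun i : Fin d => X i.castSucc) ∈ interior K}
    have hs : Convex ℝ s := by
      refine (convex_ball _ _).inter ?_
      rintro X ⟨hX1, hX2⟩ Y ⟨hY1, hY2⟩ a b ha hb hab
      refine ⟨by simp [hX1, hY1, hab], ?_⟩
      exact hconv.interior hX2 hY2 ha hb hab
    have hdf : ∀ X ∈ s, DifferentiableAt ℝ Ψ X := by
      rintro X ⟨_, hX1, hX2⟩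
      have := aux_Psi_contDiff K ψ ν hψ _ hX2
      rw [aux_liftv_init X hX1] at this
      exact this.differentiableAt (by norm_num)
    have hbd : ∀ X ∈ s, ‖fderiv ℝ Ψ X‖ ≤ C := fun X hX => (hball X hX.1).le
    have hval : ∀ y : Fin d → ℝ, Ψ (liftv y) = 400 * ψ y := by
      intro y
      have := aux_Psi_line_h ψ ν y 0 (by simp) 0
      simpa using this
    have hlc : Continuous (liftv : (Fin d → ℝ) → Fin (d+1) → ℝ) := by
      refine continuous_pi fun j => ?_
      refine Fin.lastCases ?_ (fun i => ?_) j
      · simp only [liftv, Fin.snoc_last]; exact continuous_const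
      · simp only [liftv, Fin.snoc_castSucc]; exact continuous_apply i
    have hmem : ∀ᶠ y in nhdsWithin w (interior K), liftv y ∈ s := by
      have h1 : ∀ᶠ y in nhds w, liftv y ∈ Metric.ball (liftv w) ε :=
        hlc.continuousAt.eventually (Metric.ball_mem_nhds _ hε)
      filter_upwards [nhdsWithin_le_nhds h1, self_mem_nhdsWithin] with y hy1 hy2
      refine ⟨hy1, by simp [liftv], ?_⟩
      simpa [liftv] using hy2
    have hclw : w ∈ closure (interior K) := by
      rw [hconv.closure_interior_eq_closure_of_nonempty_interior hint]
      exact subset_closure hw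
    have hne : (nhdsWithin w (interior K)).NeBot := mem_closure_iff_nhdsWithin_neBot.mp hclw
    have hfr : w ∈ frontier K := ⟨subset_closure hw, hwi⟩
    obtain ⟨y0, hy0⟩ := hmem.exists
    have htop := (hψ.blowup w hfr).eventually_gt_atTop ((Ψ (liftv y0) + C * (2 * ε)) / 400)
    obtain ⟨y, hy1, hy2⟩ := (htop.and hmem).exists
    have := hs.norm_image_sub_le_of_norm_fderiv_le hdf hbd hy0 hy2
    have h1 : ‖liftv y - liftv y0‖ ≤ 2 * ε := by
      rw [← dist_eq_norm]
      have a1 := Metric.mem_ball.mp hy2.1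
      have a2 := Metric.mem_ball'.mp hy0.1
      linarith [dist_triangle (liftv y) (liftv w) (liftv y0)]
    have h2 := (abs_le.mp ((Real.norm_eq_abs _ ▸ this))).2
    have h3 := mul_le_mul_of_nonneg_left h1 hC
    rw [hval y] at h2
    linarith
  ext i j
  simp only [hess, Matrix.of_apply, aux_der2_eq, fderiv_zero_of_not_differentiableAt hnd]
  simp


theorem aux_pull {Ω : Type*} (m : MeasurableSpace Ω) {m0 : MeasurableSpace Ω} (μ : Measure Ω)
    [IsProbabilityMeasure μ] (hm : m ≤ m0) {ι : Type*} (I : Finset ι) (c f g : ι → Ω → ℝ) (K : ℝ)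
    (hc : ∀ i ∈ I, Measurable[m] (c i)) (hcK : ∀ i ∈ I, ∀ ω, |c i ω| ≤ K)
    (hf : ∀ i ∈ I, Integrable (f i) μ) (hfg : ∀ i ∈ I, μ[f i|m] =ᵐ[μ] g i) :
    Integrable (fun ω => ∑ i ∈ I, c i ω * f i ω) μ ∧
    μ[fun ω => ∑ i ∈ I, c i ω * f i ω|m] =ᵐ[μ] fun ω => ∑ i ∈ I, c i ω * g i ω := by
  have hint : ∀ i ∈ I, Integrable (c i * f i) μ := fun i hi =>
    (hf i hi).bdd_mul ((hc i hi).mono hm le_rfl).aestronglyMeasurable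
      (Filter.Eventually.of_forall (by simpa using hcK i hi))
  refine ⟨integrable_finsetSum I hint, ?_⟩
  have e : (fun ω => ∑ i ∈ I, c i ω * f i ω) = ∑ i ∈ I, c i * f i := by
    funext ω; simp
  rw [e]
  refine (condExp_finsetSum hint m).trans ?_
  have h : ∀ i ∈ I, μ[c i * f i|m] =ᵐ[μ] c i * g i := by
    intro i hi
    refine (condExp_stronglyMeasurable_mul_of_bound hm (hc i hi).stronglyMeasurable (hf i hi) K
      (Filter.Eventually.of_forall (by simpa using hcK i hi))).trans ?_
    filter_upwards [hfg i hi] with ω hω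
    simp [hω]
  have h' : ∀ᵐ ω ∂μ, ∀ i ∈ I, (μ[c i * f i|m]) ω = (c i * g i) ω :=
    (Filter.eventually_all_finset I).mpr h
  filter_upwards [h'] with ω hω
  simp only [Finset.sum_apply]
  exact Finset.sum_congr rfl hω

theorem aux_cond {Ω : Type*} (m : MeasurableSpace Ω) {m0 : MeasurableSpace Ω} (μ : Measure Ω)
    [IsProbabilityMeasure μ] (hm : m ≤ m0) (d : ℕ) (hd : 1 ≤ d) (s nv : Ω → Fin (d+1) → ℝ)
    (κ : Ω → Measure (Fin (d+1) → ℝ)) (hκ : ∀ ω, IsProbabilityMeasure (κ ω))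
    (hnv : ∀ ω, nv ω ⬝ᵥ nv ω ≠ 0)
    (hsupp : ∀ ω, ∀ᵐ x ∂(κ ω), x ⬝ᵥ x = 1 ∧ x ⬝ᵥ nv ω = 0)
    (hunif : ∀ ω, ∀ O : Matrix (Fin (d + 1)) (Fin (d + 1)) ℝ, Oᵀ * O = 1 →
        O.mulVec (nv ω) = nv ω → (κ ω).map O.mulVec = κ ω)
    (hsm : ∀ i, Measurable fun ω => s ω i) (hs1 : ∀ ω, s ω ⬝ᵥ s ω = 1)
    (hlaw : ∀ g : (Fin (d + 1) → ℝ) → ℝ, Measurable g → (∀ x, |g x| ≤ 1) →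
      μ[fun ω => g (s ω) | m] =ᵐ[μ] fun ω => ∫ x, g x ∂(κ ω))
    (α g0 : Ω → ℝ) (β γ : Ω → Fin (d+1) → ℝ) (K : ℝ)
    (hα : Measurable[m] α) (hg0 : Measurable[m] g0) (hβ : ∀ i, Measurable[m] fun ω => β ω i)
    (hγ : ∀ i, Measurable[m] fun ω => γ ω i) (hαK : ∀ ω, |α ω| ≤ K) (hgK : ∀ ω, |g0 ω| ≤ K)
    (hβK : ∀ ω i, |β ω i| ≤ K) (hγK : ∀ ω i, |γ ω i| ≤ K)
    (hβn : ∀ ω, β ω ⬝ᵥ nv ω = 0) (hγn : ∀ ω, γ ω ⬝ᵥ nv ω = 0) :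
    μ[fun ω => (α ω + β ω ⬝ᵥ s ω) * (g0 ω + γ ω ⬝ᵥ s ω)|m] =ᵐ[μ]
      fun ω => α ω * g0 ω + (β ω ⬝ᵥ γ ω) / d := by
  have hcoord : ∀ x : Fin (d+1) → ℝ, x ⬝ᵥ x = 1 → ∀ i, |x i| ≤ 1 := by
    intro x hx i
    have h1 : x i * x i ≤ x ⬝ᵥ x :=
      Finset.single_le_sum (f := fun i => x i * x i) (fun i _ => mul_self_nonneg _) (Finset.mem_univ i)
    rw [hx] at h1
    rw [abs_le]; constructor <;> nlinarith
  have hclip : ∀ r : ℝ, |max (-1) (min 1 r)| ≤ 1 := fun r => by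
    rw [abs_le]; exact ⟨le_max_left _ _, max_le (by norm_num) (min_le_left _ _)⟩
  have hclip2 : ∀ r : ℝ, |r| ≤ 1 → max (-1) (min 1 r) = r := fun r hr => by
    have := abs_le.mp hr
    rw [min_eq_right this.2, max_eq_right this.1]
  have hlaw' : ∀ g : (Fin (d + 1) → ℝ) → ℝ, Measurable g → (∀ x, x ⬝ᵥ x = 1 → |g x| ≤ 1) →
      μ[fun ω => g (s ω) | m] =ᵐ[μ] fun ω => ∫ x, g x ∂(κ ω) := by
    intro g hg hgb
    have h := hlaw (fun x => max (-1) (min 1 (g x)))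
      (measurable_const.max (measurable_const.min hg)) (fun x => hclip _)
    have e1 : (fun ω => max (-1) (min 1 (g (s ω)))) = fun ω => g (s ω) := by
      funext ω; exact hclip2 _ (hgb _ (hs1 ω))
    simp only [e1] at h
    refine h.trans (Filter.Eventually.of_forall fun ω => ?_)
    apply integral_congr_ae
    filter_upwards [hsupp ω] with x hx
    exact hclip2 _ (hgb _ hx.1)
  have L1 : ∀ i, μ[fun ω => s ω i|m] =ᵐ[μ] fun ω => ∫ x, x i ∂(κ ω) := fun i =>
    hlaw' (fun x => x i) (measurable_pi_apply i) (fun x hx => hcoord x hx i)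
  have L2 : ∀ i j, μ[fun ω => s ω i * s ω j|m] =ᵐ[μ] fun ω => ∫ x, x i * x j ∂(κ ω) := fun i j =>
    hlaw' (fun x => x i * x j) (by fun_prop) (fun x hx => by
      rw [abs_mul]
      exact mul_le_one₀ (hcoord x hx i) (abs_nonneg _) (hcoord x hx j))
  have hsi : ∀ i, Integrable (fun ω => s ω i) μ := fun i =>
    aux_int_bdd μ _ (hsm i) 1 fun ω => hcoord _ (hs1 ω) i
  have hsij : ∀ i j, Integrable (fun ω => s ω i * s ω j) μ := fun i j =>
    aux_int_bdd μ _ ((hsm i).mul (hsm j)) 1 fun ω => by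
      rw [abs_mul]
      exact mul_le_one₀ (hcoord _ (hs1 ω) i) (abs_nonneg _) (hcoord _ (hs1 ω) j)
  have hmul : ∀ a b : ℝ, |a| ≤ K → |b| ≤ K → |a * b| ≤ K * K := fun a b ha hb => by
    rw [abs_mul]; exact mul_le_mul ha hb (abs_nonneg _) ((abs_nonneg _).trans ha)
  obtain ⟨i1, p1⟩ := aux_pull m μ hm (Finset.univ : Finset (Fin (d+1)))
    (fun i ω => α ω * γ ω i + g0 ω * β ω i) (fun i ω => s ω i) (fun i ω => ∫ x, x i ∂(κ ω))
    (K * K + K * K) (fun i _ => (hα.mul (hγ i)).add (hg0.mul (hβ i)))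
    (fun i _ ω => (abs_add_le _ _).trans (add_le_add (hmul _ _ (hαK ω) (hγK ω i))
      (hmul _ _ (hgK ω) (hβK ω i)))) (fun i _ => hsi i) (fun i _ => L1 i)
  obtain ⟨i2, p2⟩ := aux_pull m μ hm (Finset.univ : Finset (Fin (d+1) × Fin (d+1)))
    (fun i ω => β ω i.1 * γ ω i.2) (fun i ω => s ω i.1 * s ω i.2)
    (fun i ω => ∫ x, x i.1 * x i.2 ∂(κ ω))
    (K * K) (fun i _ => (hβ i.1).mul (hγ i.2))
    (fun i _ ω => (hmul _ _ (hβK ω i.1) (hγK ω i.2))) (fun i _ => hsij i.1 i.2)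
    (fun i _ => L2 i.1 i.2)
  have i0 : Integrable (fun ω => α ω * g0 ω) μ :=
    aux_int_bdd μ _ ((hα.mul hg0).mono hm le_rfl) (K * K) fun ω => hmul _ _ (hαK ω) (hgK ω)
  have p0 : μ[fun ω => α ω * g0 ω|m] = fun ω => α ω * g0 ω :=
    condExp_of_stronglyMeasurable hm (hα.mul hg0).stronglyMeasurable i0
  have hdec : (fun ω => (α ω + β ω ⬝ᵥ s ω) * (g0 ω + γ ω ⬝ᵥ s ω)) =
      (fun ω => α ω * g0 ω) + ((fun ω => ∑ i, (α ω * γ ω i + g0 ω * β ω i) * s ω i) +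
        fun ω => ∑ i : Fin (d+1) × Fin (d+1), (β ω i.1 * γ ω i.2) * (s ω i.1 * s ω i.2)) := by
    funext ω
    simp only [Pi.add_apply, Fintype.sum_prod_type, add_mul, Finset.sum_add_distrib]
    have a1 : ∑ i, α ω * γ ω i * s ω i = α ω * (γ ω ⬝ᵥ s ω) := by
      simp only [dotProduct, Finset.mul_sum, mul_assoc]
    have a2 : ∑ i, g0 ω * β ω i * s ω i = g0 ω * (β ω ⬝ᵥ s ω) := by
      simp only [dotProduct, Finset.mul_sum, mul_assoc]
    have a3 : ∑ i, ∑ j, β ω i * γ ω j * (s ω i * s ω j) = (β ω ⬝ᵥ s ω) * (γ ω ⬝ᵥ s ω) := by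
      simp only [dotProduct, Finset.sum_mul_sum]
      exact Finset.sum_congr rfl fun i _ => Finset.sum_congr rfl fun j _ => by ring
    rw [a1, a2, a3]; ring
  rw [hdec]
  have q1 := condExp_add i0 (i1.add i2) m
  have q2 := condExp_add i1 i2 m
  filter_upwards [q1, q2, p1, p2] with ω q1 q2 p1 p2
  rw [q1, Pi.add_apply, q2, Pi.add_apply, p1, p2, p0]
  have hκω := hκ ω
  have m1 : ∀ v : Fin (d+1) → ℝ, v ⬝ᵥ nv ω = 0 → ∑ i, v i * ∫ x, x i ∂(κ ω) = 0 := by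
    intro v hv
    rw [← aux_moment1 (κ ω) (nv ω) (hunif ω) v hv]
    simp only [dotProduct]
    rw [integral_finsetSum]
    · exact Finset.sum_congr rfl fun i _ => (integral_const_mul _ _).symm
    · intro i _; exact aux_bdd_supp (κ ω) (nv ω) (hsupp ω) _ (by fun_prop)
  have m2 : ∑ i : Fin (d+1) × Fin (d+1), (β ω i.1 * γ ω i.2) * ∫ x, x i.1 * x i.2 ∂(κ ω) =
      (β ω ⬝ᵥ γ ω) / d := by
    rw [← aux_moment2 (κ ω) (nv ω) hd (hnv ω) (hsupp ω) (hunif ω) _ _ (hβn ω) (hγn ω)]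
    have : ∀ x : Fin (d+1) → ℝ, (β ω ⬝ᵥ x) * (γ ω ⬝ᵥ x) =
        ∑ i : Fin (d+1) × Fin (d+1), (β ω i.1 * γ ω i.2) * (x i.1 * x i.2) := by
      intro x
      simp only [dotProduct, Finset.sum_mul_sum, Fintype.sum_prod_type]
      exact Finset.sum_congr rfl fun i _ => Finset.sum_congr rfl fun j _ => by ring
    simp only [this]
    rw [integral_finsetSum]
    · exact Finset.sum_congr rfl fun i _ => (integral_const_mul _ _).symm
    · intro i _; exact aux_bdd_supp (κ ω) (nv ω) (hsupp ω) _ (by fun_prop)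
  rw [m2]
  have m3 : ∑ i, (α ω * γ ω i + g0 ω * β ω i) * ∫ x, x i ∂(κ ω) = 0 := by
    have := m1 (α ω • γ ω + g0 ω • β ω) (by
      rw [add_dotProduct, smul_dotProduct, smul_dotProduct, hβn, hγn]; simp)
    simpa using this
  rw [m3, zero_add]


theorem aux_dotp_eq {n : ℕ} (x y : Fin n → ℝ) : dotp x y = x ⬝ᵥ y := rfl

theorem aux_cs {n : ℕ} (x y : Fin n → ℝ) : |x ⬝ᵥ y| ≤ √(x ⬝ᵥ x) * √(y ⬝ᵥ y) := by
  rw [← Real.sqrt_mul (aux_dot_nonneg x)]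
  apply Real.abs_le_sqrt
  have := Finset.sum_mul_sq_le_sq_mul_sq Finset.univ x y
  simpa [dotProduct, pow_two] using this

theorem aux_coord {n : ℕ} (v nn : Fin n → ℝ) (B : ℝ) (hB : 0 ≤ B) (hv : v ⬝ᵥ nn = 0)
    (h : ∀ s : Fin n → ℝ, s ⬝ᵥ s = 1 → s ⬝ᵥ nn = 0 → |v ⬝ᵥ s| ≤ B) (i : Fin n) : |v i| ≤ B := by
  have hn := aux_dot_nonneg v
  have h1 : v i * v i ≤ v ⬝ᵥ v :=
    Finset.single_le_sum (f := fun i => v i * v i) (fun i _ => mul_self_nonneg _) (Finset.mem_univ i)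
  have h2 : |v i| ≤ √(v ⬝ᵥ v) := Real.abs_le_sqrt (by nlinarith)
  refine h2.trans ?_
  rcases hn.eq_or_lt with h0 | h0
  · rw [← h0]; simpa
  · have hs := Real.sqrt_pos.mpr h0
    have hss := Real.mul_self_sqrt h0.le
    have := h ((√(v ⬝ᵥ v))⁻¹ • v) (by
      rw [smul_dotProduct, dotProduct_smul, smul_eq_mul, smul_eq_mul]
      generalize v ⬝ᵥ v = a at *
      field_simp; nlinarith) (by rw [smul_dotProduct, hv, smul_zero])
    rw [dotProduct_smul, smul_eq_mul] at this
    have e : (√(v ⬝ᵥ v))⁻¹ * (v ⬝ᵥ v) = √(v ⬝ᵥ v) := by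
      generalize v ⬝ᵥ v = a at *
      field_simp; nlinarith
    rw [e, abs_of_pos hs] at this
    exact this

theorem aux_symm_dot {n : ℕ} (A : Matrix (Fin n) (Fin n) ℝ) (hA : Aᵀ = A) (x y : Fin n → ℝ) :
    (A.mulVec x) ⬝ᵥ y = x ⬝ᵥ A.mulVec y := by
  rw [dotProduct_mulVec, ← mulVec_transpose, hA]

theorem aux_round {d : ℕ} (K : Set (Fin d → ℝ)) (hconv : Convex ℝ K) (hcl : IsClosed K)
    (hint : (interior K).Nonempty) (ψ : (Fin d → ℝ) → ℝ) (ν : ℝ) (hψ : IsSCB K ψ ν)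
    (wv : Fin (d+1) → ℝ) (hwv : wv ∈ liftv '' K) (R : Matrix (Fin (d+1)) (Fin (d+1)) ℝ)
    (hRp : R.PosDef) (hRs : R.IsSymm) (hRR : R * R = hess (liftedBarrier ψ ν) wv)
    (l : Fin d → ℝ) (hl : ∀ w ∈ K, |dotp w l| ≤ 1)
    (uv : Fin (d+1) → ℝ) (huv : uv ∈ liftv '' K)
    (nn lp β γ : Fin (d+1) → ℝ) (hnn : nn = R⁻¹.mulVec (Pi.single (Fin.last d) 1))
    (hlp : lp = Fin.snoc l 0) (hγ : γ = R.mulVec (uv - wv))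
    (hβ : β = R⁻¹.mulVec lp - ((R⁻¹.mulVec lp ⬝ᵥ nn) / (nn ⬝ᵥ nn)) • nn)
    (G : ℝ) (hG : G = √(800*ν) + qnorm (hess (liftedBarrier ψ ν) wv) uv) :
    nn ⬝ᵥ nn ≠ 0 ∧ |dotp wv lp| ≤ 1 ∧ |dotp uv lp| ≤ 1 ∧
    (∀ s, s ⬝ᵥ s = 1 → s ⬝ᵥ nn = 0 → |dotp (wv + R⁻¹.mulVec s) lp| ≤ 1) ∧
    γ ⬝ᵥ nn = 0 ∧ (∀ s, s ⬝ᵥ s = 1 → |γ ⬝ᵥ s| ≤ G) ∧ β ⬝ᵥ nn = 0 ∧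
    (∀ s, s ⬝ᵥ nn = 0 → dotp (wv + R⁻¹.mulVec s) lp = dotp wv lp + β ⬝ᵥ s) ∧
    β ⬝ᵥ γ = dotp uv lp - dotp wv lp ∧ (∀ i, |β i| ≤ 2) ∧ (∀ i, |γ i| ≤ G) := by
  have hdot : ∀ x : Fin d → ℝ, ∀ c : ℝ, dotp (Fin.snoc x c) lp = dotp x l := by
    intro x c
    rw [hlp]; simp [dotp, Fin.sum_univ_castSucc]
  have hRu : IsUnit R.det := (Matrix.isUnit_iff_isUnit_det R).mp hRp.isUnit
  have hi1 : R * R⁻¹ = 1 := Matrix.mul_nonsing_inv _ hRu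
  have hi2 : R⁻¹ * R = 1 := Matrix.nonsing_inv_mul _ hRu
  have hRt : Rᵀ = R := hRs
  have hRit : (R⁻¹)ᵀ = R⁻¹ := by rw [Matrix.transpose_nonsing_inv, hRt]
  have a1 : ∀ x, R.mulVec (R⁻¹.mulVec x) = x := fun x => by
    rw [Matrix.mulVec_mulVec, hi1, Matrix.one_mulVec]
  have a2 : ∀ x, R⁻¹.mulVec (R.mulVec x) = x := fun x => by
    rw [Matrix.mulVec_mulVec, hi2, Matrix.one_mulVec]
  have hlast : ∀ x : Fin (d+1) → ℝ, x ⬝ᵥ (Pi.single (Fin.last d) 1 : Fin (d+1) → ℝ) = x (Fin.last d) := by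
    intro x; simp
  have hquad : ∀ x, dotp x ((hess (liftedBarrier ψ ν) wv).mulVec x) = R.mulVec x ⬝ᵥ R.mulVec x := by
    intro x
    rw [aux_symm_dot R hRt, aux_dotp_eq, ← hRR, Matrix.mulVec_mulVec]
  obtain ⟨w, hwK, rfl⟩ := hwv
  obtain ⟨u, huK, rfl⟩ := huv
  have hn0 : nn ⬝ᵥ nn ≠ 0 := by
    intro h
    have h0 : nn = 0 := dotProduct_self_eq_zero.mp h
    have := a1 (Pi.single (Fin.last d) 1)
    rw [← hnn, h0, Matrix.mulVec_zero] at this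
    have := congrFun this (Fin.last d)
    simp at this
  have hwi : w ∈ interior K := by
    by_contra hwi
    have h0 := aux_boundary K hconv hcl hint ψ ν hψ w hwK hwi
    rw [h0] at hRR
    have : R = 0 := by
      calc R = R⁻¹ * (R * R) := by rw [← Matrix.mul_assoc, hi2, Matrix.one_mul]
        _ = 0 := by rw [hRR, Matrix.mul_zero]
    rw [this] at hi1
    have := congrFun (congrFun hi1 (Fin.last d)) (Fin.last d)
    simp at this
  have hsn : ∀ s, s ⬝ᵥ nn = (R⁻¹.mulVec s) (Fin.last d) := by
    intro s
    rw [hnn, ← aux_symm_dot _ hRit, hlast]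
  have hA : ∀ s, s ⬝ᵥ s = 1 → s ⬝ᵥ nn = 0 → |dotp (liftv w + R⁻¹.mulVec s) lp| ≤ 1 := by
    intro s hs1 hs2
    rw [hsn] at hs2
    set h := R⁻¹.mulVec s with hh
    have e1 := hquad h
    rw [aux_hess_form, hh, a1, hs1, ← hh, aux_Psi_der2_h K ψ ν hψ w hwi h hs2] at e1
    have := aux_dikin K ψ ν hψ w (fun i => h i.castSucc) hwi (by linarith)
    have e2 : liftv w + h = Fin.snoc (w + fun i => h i.castSucc) 1 := by
      funext i
      refine Fin.lastCases ?_ (fun i => ?_) i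
      · simp [liftv, hs2]
      · simp [liftv]
    rw [e2, hdot]
    exact hl _ (interior_subset this)
  have hw1 : |dotp (liftv w) lp| ≤ 1 := by rw [liftv, hdot]; exact hl _ hwK
  have hu1 : |dotp (liftv u) lp| ≤ 1 := by rw [liftv, hdot]; exact hl _ huK
  have hγn : γ ⬝ᵥ nn = 0 := by
    rw [hsn, hγ, a2]; simp [liftv]
  have hγs : ∀ s, s ⬝ᵥ s = 1 → |γ ⬝ᵥ s| ≤ G := by
    intro s hs
    rw [hγ, Matrix.mulVec_sub, sub_dotProduct, hG]
    have c1 := aux_cs (R.mulVec (liftv u)) s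
    have c2 := aux_cs (R.mulVec (liftv w)) s
    have e2 := hquad (liftv w)
    rw [aux_hess_form, aux_Psi_der2_w K ψ ν hψ w hwi] at e2
    rw [hs, Real.sqrt_one, mul_one, ← hquad] at c1
    rw [hs, Real.sqrt_one, mul_one, ← e2] at c2
    have := abs_sub (R.mulVec (liftv u) ⬝ᵥ s) (R.mulVec (liftv w) ⬝ᵥ s)
    unfold qnorm
    linarith
  have hG0 : 0 ≤ G := by rw [hG]; unfold qnorm; positivity
  have hβn : β ⬝ᵥ nn = 0 := by
    rw [hβ, sub_dotProduct, smul_dotProduct, smul_eq_mul, div_mul_cancel₀ _ hn0, sub_self]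
  have hβs : ∀ s, s ⬝ᵥ nn = 0 → β ⬝ᵥ s = R⁻¹.mulVec lp ⬝ᵥ s := by
    intro s hs
    rw [hβ, sub_dotProduct, smul_dotProduct, dotProduct_comm nn s, hs, smul_zero, sub_zero]
  have hAs : ∀ s, s ⬝ᵥ nn = 0 → dotp (liftv w + R⁻¹.mulVec s) lp = dotp (liftv w) lp + β ⬝ᵥ s := by
    intro s hs
    rw [hβs s hs, aux_symm_dot _ hRit, aux_dotp_eq, aux_dotp_eq, add_dotProduct,
      dotProduct_comm lp]
  refine ⟨hn0, hw1, hu1, hA, hγn, hγs, hβn, hAs, ?_, ?_, ?_⟩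
  · rw [hβs γ hγn, aux_symm_dot _ hRit, hγ, a2, dotProduct_sub, aux_dotp_eq, aux_dotp_eq,
      dotProduct_comm lp, dotProduct_comm lp]
  · apply aux_coord β nn 2 (by norm_num) hβn
    intro s h1 h2
    have b1 := hA s h1 h2
    rw [hAs s h2] at b1
    rw [abs_le] at *
    constructor <;> linarith
  · exact aux_coord γ nn G hG0 hγn (fun s h1 _ => hγs s h1)


theorem aux_hess_meas {Ω : Type*} (m : MeasurableSpace Ω) {n : ℕ} (f : (Fin n → ℝ) → ℝ)
    (w : Ω → Fin n → ℝ) (hw : ∀ i, Measurable fun ω => w ω i) (i j : Fin n) :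
    Measurable fun ω => hess f (w ω) i j := by
  have hw' : Measurable w := measurable_pi_iff.mpr hw
  have h1 : Measurable (fderiv ℝ (fderiv ℝ f)) := measurable_fderiv ℝ (fderiv ℝ f)
  have h2 : Measurable (fun x => fderiv ℝ (fderiv ℝ f) x (Pi.single i 1)) :=
    measurable_fderiv_apply_const ℝ (fderiv ℝ f) _
  have h3 : Measurable (fun x => fderiv ℝ (fderiv ℝ f) x (Pi.single i 1) (Pi.single j 1)) :=
    (ContinuousLinearMap.apply ℝ ℝ (Pi.single j 1 : Fin n → ℝ)).continuous.measurable.comp h2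
  have e : (fun ω => hess f (w ω) i j) =
      fun ω => fderiv ℝ (fderiv ℝ f) (w ω) (Pi.single i 1) (Pi.single j 1) := by
    funext ω
    rw [hess, Matrix.of_apply, aux_der2_eq]
  rw [e]
  exact h3.comp hw'

theorem aux_dot_meas {Ω : Type*} (m : MeasurableSpace Ω) {n : ℕ} (x y : Ω → Fin n → ℝ)
    (hx : ∀ i, Measurable fun ω => x ω i) (hy : ∀ i, Measurable fun ω => y ω i) :
    Measurable fun ω => x ω ⬝ᵥ y ω :=
  Finset.measurable_sum _ fun i _ => (hx i).mul (hy i)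

theorem aux_mulVec_meas {Ω : Type*} (m : MeasurableSpace Ω) {n : ℕ}
    (A : Ω → Matrix (Fin n) (Fin n) ℝ) (y : Ω → Fin n → ℝ)
    (hA : ∀ i j, Measurable fun ω => A ω i j) (hy : ∀ i, Measurable fun ω => y ω i) (i : Fin n) :
    Measurable fun ω => (A ω).mulVec (y ω) i :=
  aux_dot_meas m (fun ω => A ω i) y (hA i) hy

theorem aux_inv_meas {Ω : Type*} (m : MeasurableSpace Ω) {n : ℕ}
    (A : Ω → Matrix (Fin n) (Fin n) ℝ) (hA : ∀ i j, Measurable fun ω => A ω i j) (i j : Fin n) :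
    Measurable fun ω => (A ω)⁻¹ i j := by
  have hA' : Measurable (fun ω => fun i j => A ω i j : Ω → Fin n → Fin n → ℝ) :=
    measurable_pi_iff.mpr fun i => measurable_pi_iff.mpr fun j => hA i j
  have c1 : Continuous (fun B : Fin n → Fin n → ℝ => (Matrix.of B).det) :=
    Continuous.matrix_det (A := fun B : Fin n → Fin n → ℝ => Matrix.of B) continuous_id
  have c2 : Continuous (fun B : Fin n → Fin n → ℝ => (Matrix.of B).adjugate i j) :=
    (Continuous.matrix_adjugate (A := fun B : Fin n → Fin n → ℝ => Matrix.of B) continuous_id).matrix_elem i j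
  have e : (fun ω => (A ω)⁻¹ i j) = fun ω => (A ω).det⁻¹ * (A ω).adjugate i j := by
    funext ω
    rw [Matrix.inv_def, Matrix.smul_apply, Ring.inverse_eq_inv', smul_eq_mul]
  rw [e]
  exact (c1.measurable.comp hA').inv.mul (c2.measurable.comp hA')

theorem aux_qnorm_meas {Ω : Type*} (m : MeasurableSpace Ω) {n : ℕ}
    (A : Ω → Matrix (Fin n) (Fin n) ℝ) (hA : ∀ i j, Measurable fun ω => A ω i j) (u : Fin n → ℝ) :
    Measurable fun ω => qnorm (A ω) u :=
  (aux_dot_meas m (fun _ => u) _ (fun _ => measurable_const)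
    (aux_mulVec_meas m A (fun _ => u) hA fun _ => measurable_const)).sqrt

theorem aux_proc {Ω : Type*} (m m' : MeasurableSpace Ω) {m0 : MeasurableSpace Ω} (μ : Measure Ω)
    [IsProbabilityMeasure μ] (hmm' : m ≤ m') (hm' : m' ≤ m0) {d : ℕ} (hd : 1 ≤ d)
    (K : Set (Fin d → ℝ)) (hconv : Convex ℝ K) (hcl : IsClosed K)
    (hint : (interior K).Nonempty) (ψ : (Fin d → ℝ) → ℝ) (ν : ℝ) (hψ : IsSCB K ψ ν)
    (w s : Ω → Fin (d+1) → ℝ) (hwK : ∀ ω, w ω ∈ liftv '' K)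
    (R : Ω → Matrix (Fin (d+1)) (Fin (d+1)) ℝ)
    (hR : ∀ ω, (R ω).PosDef ∧ (R ω).IsSymm ∧ R ω * R ω = hess (liftedBarrier ψ ν) (w ω))
    (l : Ω → Fin d → ℝ) (hl : ∀ ω, ∀ w ∈ K, |dotp w (l ω)| ≤ 1)
    (u : Fin (d+1) → ℝ) (hu : u ∈ liftv '' K)
    (κ : Ω → Measure (Fin (d+1) → ℝ)) (hκ : ∀ ω, IsProbabilityMeasure (κ ω))
    (hsupp : ∀ ω, ∀ᵐ x ∂(κ ω), dotp x x = 1 ∧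
      dotp x ((R ω)⁻¹.mulVec (Pi.single (Fin.last d) 1)) = 0)
    (hunif : ∀ ω, ∀ O : Matrix (Fin (d + 1)) (Fin (d + 1)) ℝ, Oᵀ * O = 1 →
        O.mulVec ((R ω)⁻¹.mulVec (Pi.single (Fin.last d) 1)) =
          (R ω)⁻¹.mulVec (Pi.single (Fin.last d) 1) → (κ ω).map O.mulVec = κ ω)
    (hlaw : ∀ g : (Fin (d + 1) → ℝ) → ℝ, Measurable g → (∀ x, |g x| ≤ 1) →
      μ[fun ω => g (s ω) | m] =ᵐ[μ] fun ω => ∫ x, g x ∂(κ ω))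
    (hs : ∀ ω, dotp (s ω) (s ω) = 1 ∧
      dotp (s ω) ((R ω)⁻¹.mulVec (Pi.single (Fin.last d) 1)) = 0)
    (hlm : ∀ i, Measurable[m] fun ω => l ω i) (hwm : ∀ i, Measurable[m] fun ω => w ω i)
    (hsm : ∀ i, Measurable[m'] fun ω => s ω i)
    (lp wt lh : Ω → Fin (d+1) → ℝ) (hlp : ∀ ω, lp ω = Fin.snoc (l ω) 0)
    (hwt : ∀ ω, wt ω = w ω + (R ω)⁻¹.mulVec (s ω))
    (hlh : ∀ ω, lh ω = ((d : ℝ) * dotp (wt ω) (lp ω)) • (R ω).mulVec (s ω))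
    (M : Ω → ℝ) (hMm : Measurable[m] M)
    (hM : ∀ ω, 1 + d * (√(800*ν) + qnorm (hess (liftedBarrier ψ ν) (w ω)) u) ≤ M ω) :
    ∃ Y y : Ω → ℝ, Measurable[m'] Y ∧ (∀ ω, |Y ω| ≤ 1) ∧
      Measurable[m'] (fun ω => |dotp (wt ω) (lp ω)|) ∧ (∀ ω, |dotp (wt ω) (lp ω)| ≤ 1) ∧
      (∀ ω, Y ω ^ 2 ≤ |dotp (wt ω) (lp ω)|) ∧ Measurable[m] y ∧ (∀ ω, |y ω| ≤ 1) ∧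
      μ[Y|m] =ᵐ[μ] y ∧
      ∀ ω, dotp (wt ω) (lp ω) - dotp (w ω) (lh ω) + dotp u (lh ω - lp ω) = M ω * (Y ω - y ω) := by
  have hdR : (0:ℝ) < d := by exact_mod_cast hd
  set H : Ω → Matrix (Fin (d+1)) (Fin (d+1)) ℝ := fun ω => hess (liftedBarrier ψ ν) (w ω) with hH
  have hHm : ∀ i j, Measurable[m] fun ω => H ω i j := aux_hess_meas m _ w hwm
  have hRm : ∀ i j, Measurable[m] fun ω => R ω i j :=
    aux_R_meas m (fun ω => R ω) (fun ω => H ω) hHm (fun ω => ⟨(hR ω).1, (hR ω).2.2⟩)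
  have hRim := aux_inv_meas m R hRm
  have hlpm : ∀ i, Measurable[m] fun ω => lp ω i := by
    intro i
    simp only [hlp]
    refine Fin.lastCases ?_ (fun i => ?_) i
    · simp
    · simpa using hlm i
  set nn : Ω → Fin (d+1) → ℝ := fun ω => (R ω)⁻¹.mulVec (Pi.single (Fin.last d) 1) with hnn
  have hnm : ∀ i, Measurable[m] fun ω => nn ω i :=
    aux_mulVec_meas m _ _ hRim fun i => measurable_const
  set γ : Ω → Fin (d+1) → ℝ := fun ω => (R ω).mulVec (u - w ω) with hγ
  have hγm : ∀ i, Measurable[m] fun ω => γ ω i :=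
    aux_mulVec_meas m _ _ hRm fun i => measurable_const.sub (hwm i)
  have hRl : ∀ i, Measurable[m] fun ω => ((R ω)⁻¹.mulVec (lp ω)) i :=
    aux_mulVec_meas m _ _ hRim hlpm
  set β : Ω → Fin (d+1) → ℝ := fun ω => (R ω)⁻¹.mulVec (lp ω) -
    (((R ω)⁻¹.mulVec (lp ω) ⬝ᵥ nn ω) / (nn ω ⬝ᵥ nn ω)) • nn ω with hβ
  have hβm : ∀ i, Measurable[m] fun ω => β ω i := fun i =>
    (hRl i).sub (((aux_dot_meas m _ _ hRl hnm).div (aux_dot_meas m _ _ hnm hnm)).mul (hnm i))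
  have hαm : Measurable[m] fun ω => dotp (w ω) (lp ω) := aux_dot_meas m _ _ hwm hlpm
  have hum : Measurable[m] fun ω => dotp u (lp ω) :=
    aux_dot_meas m _ _ (fun _ => measurable_const) hlpm
  have key := fun ω => aux_round K hconv hcl hint ψ ν hψ (w ω) (hwK ω) (R ω) (hR ω).1 (hR ω).2.1
    (hR ω).2.2 (l ω) (hl ω) u hu (nn ω) (lp ω) (β ω) (γ ω) rfl (hlp ω) rfl rfl _ rfl
  choose k1 k2 k3 k4 k5 k6 k7 k8 k9 k10 k11 using key
  have hs1 : ∀ ω, s ω ⬝ᵥ s ω = 1 := fun ω => (hs ω).1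
  have hsn : ∀ ω, s ω ⬝ᵥ nn ω = 0 := fun ω => (hs ω).2
  have hA : ∀ ω, dotp (wt ω) (lp ω) = dotp (w ω) (lp ω) + β ω ⬝ᵥ s ω := fun ω => by
    rw [hwt, k8 ω _ (hsn ω)]
  have hA1 : ∀ ω, |dotp (wt ω) (lp ω)| ≤ 1 := fun ω => by
    rw [hwt]; exact k4 ω _ (hs1 ω) (hsn ω)
  have hG0 : ∀ ω, 0 ≤ √(800*ν) + qnorm (H ω) u := fun ω => by unfold qnorm; positivity
  have hM1 : ∀ ω, 1 ≤ M ω := fun ω => by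
    have := hM ω; have := mul_nonneg hdR.le (hG0 ω); simp only [hH] at *; linarith
  have hM0 : ∀ ω, 0 < M ω := fun ω => lt_of_lt_of_le one_pos (hM1 ω)
  have hdG : ∀ ω, d * (√(800*ν) + qnorm (H ω) u) ≤ M ω := fun ω => by
    have := hM ω; simp only [hH] at *; linarith
  have hsm' := fun i => (hsm i)
  have hAm : Measurable[m'] fun ω => dotp (wt ω) (lp ω) := by
    simp only [hA]
    exact (hαm.mono hmm' le_rfl).add
      (aux_dot_meas m' _ _ (fun i => (hβm i).mono hmm' le_rfl) hsm)
  set γ' : Ω → Fin (d+1) → ℝ := fun ω => (d / M ω) • γ ω with hγ'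
  have hγ'm : ∀ i, Measurable[m] fun ω => γ' ω i := fun i =>
    (measurable_const.div hMm).mul (hγm i)
  have hfac : ∀ ω, (M ω)⁻¹ + γ' ω ⬝ᵥ s ω = (1 + d * (γ ω ⬝ᵥ s ω)) / M ω := fun ω => by
    have := (hM0 ω).ne'
    simp only [hγ', smul_dotProduct, smul_eq_mul]
    field_simp
  have hfac1 : ∀ ω, |(M ω)⁻¹ + γ' ω ⬝ᵥ s ω| ≤ 1 := fun ω => by
    rw [hfac, abs_div, abs_of_pos (hM0 ω), div_le_one (hM0 ω)]
    have h1 := k6 ω _ (hs1 ω)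
    have h2 := mul_le_mul_of_nonneg_left h1 hdR.le
    have h3 : |1 + d * (γ ω ⬝ᵥ s ω)| ≤ |1| + |d * (γ ω ⬝ᵥ s ω)| := abs_add_le _ _
    rw [abs_mul, abs_one, abs_of_pos hdR] at h3
    exact h3.trans (le_trans (by linarith) (hM ω))
  have hcond := aux_cond m μ (hmm'.trans hm') d hd s nn κ hκ k1 hsupp hunif
    (fun i => (hsm i).mono hm' le_rfl) hs1 hlaw (fun ω => dotp (w ω) (lp ω)) (fun ω => (M ω)⁻¹)
    β γ' 2 hαm hMm.inv hβm hγ'm (fun ω => (k2 ω).trans (by norm_num))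
    (fun ω => by rw [abs_of_pos (inv_pos.mpr (hM0 ω))]
                 exact (inv_le_one_of_one_le₀ (hM1 ω)).trans (by norm_num)) k10
    (fun ω i => by
      simp only [hγ', Pi.smul_apply, smul_eq_mul, abs_mul, abs_div, abs_of_pos (hM0 ω), abs_of_pos hdR]
      rw [div_mul_eq_mul_div, div_le_iff₀ (hM0 ω)]
      have := mul_le_mul_of_nonneg_left (k11 ω i) hdR.le
      have := hdG ω
      have := hM0 ω
      simp only [hH] at *
      linarith) k7
    (fun ω => by simp only [hγ', smul_dotProduct, k5, smul_zero])
  have hAabs : Measurable[m'] fun ω => |dotp (wt ω) (lp ω)| :=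
    measurable_abs.comp hAm
  refine ⟨fun ω => (dotp (w ω) (lp ω) + β ω ⬝ᵥ s ω) * ((M ω)⁻¹ + γ' ω ⬝ᵥ s ω),
    fun ω => dotp u (lp ω) / M ω, ?_, ?_, hAabs, hA1, ?_, hum.div hMm, ?_, ?_, ?_⟩
  · simp only [← hA]
    exact hAm.mul ((hMm.inv.mono hmm' le_rfl).add
      (aux_dot_meas m' _ _ (fun i => (hγ'm i).mono hmm' le_rfl) hsm))
  · intro ω
    simp only [← hA, abs_mul]
    exact mul_le_one₀ (hA1 ω) (abs_nonneg _) (hfac1 ω)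
  · intro ω
    simp only [← hA, mul_pow]
    rw [← sq_abs, ← sq_abs (_ + _)]
    have h1 := hA1 ω
    have h2 := hfac1 ω
    have h3 := abs_nonneg (dotp (wt ω) (lp ω))
    have h4 := abs_nonneg ((M ω)⁻¹ + γ' ω ⬝ᵥ s ω)
    calc _ ≤ |dotp (wt ω) (lp ω)| ^ 2 * 1 := by
          apply mul_le_mul_of_nonneg_left _ (by positivity)
          nlinarith
      _ ≤ _ := by nlinarith
  · intro ω
    dsimp only
    rw [abs_div, abs_of_pos (hM0 ω), div_le_one (hM0 ω)]
    exact (k3 ω).trans (hM1 ω)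
  · refine hcond.trans (Filter.Eventually.of_forall fun ω => ?_)
    have := (hM0 ω).ne'
    simp only [hγ', dotProduct_smul, smul_eq_mul, k9]
    field_simp
    ring
  · intro ω
    have hne := (hM0 ω).ne'
    have e1 : dotp u (lh ω - lp ω) - dotp (w ω) (lh ω) =
        d * dotp (wt ω) (lp ω) * (γ ω ⬝ᵥ s ω) - dotp u (lp ω) := by
      have e2 : γ ω ⬝ᵥ s ω = (u - w ω) ⬝ᵥ (R ω).mulVec (s ω) := aux_symm_dot _ (hR ω).2.1 _ _
      rw [e2, hlh]
      simp only [aux_dotp_eq, dotProduct_sub, sub_dotProduct, dotProduct_smul, smul_eq_mul]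
      ring
    have e3 : dotp (wt ω) (lp ω) - dotp (w ω) (lh ω) + dotp u (lh ω - lp ω) =
        dotp (wt ω) (lp ω) + (dotp u (lh ω - lp ω) - dotp (w ω) (lh ω)) := by ring
    rw [e3, e1]
    simp only [← hA, hfac]
    field_simp
    ring


set_option maxHeartbeats 1000000 in
theorem aux_arith (d T : ℕ) (hd : 1 ≤ d) (hT : 2 ≤ T) (ν δ ρ V U M L' : ℝ) (hν : 1 ≤ ν)
    (hδ0 : 0 < δ) (hδ1 : δ < 1) (hρ : 0 ≤ ρ) (hV : 0 ≤ V) (hM0 : 0 ≤ M)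
    (hM : M ≤ 1 + d * (√(800*ν) + ρ)) (hL' : L' = Real.log (2*T*(T+1)/δ))
    (b : ℝ) (hb : b = 2 * 10 ^ 6 * d * ν ^ 2 * T)
    (C : ℕ) (hC : C = ⌈Real.logb 2 b⌉₊ * ⌈Real.logb 2 (b ^ 2 * T)⌉₊) :
    2 * M * (2 * √(V * L') + L') ≤
      161 * C * d * √((ν + ρ ^ 2) * V * Real.log (C / δ)) + C * √(32 * U * Real.log (C / δ))
      + 64 * C * d * (√ν + ρ) * Real.log (C / δ) := by
  have hdR : (1:ℝ) ≤ d := by exact_mod_cast hd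
  have hTR : (2:ℝ) ≤ T := by exact_mod_cast hT
  have hb1 : 2 * 10^6 * (T:ℝ) ≤ b := by
    rw [hb]
    have h1 : 1 ≤ (d:ℝ) * ν^2 := by nlinarith [one_le_pow₀ hν (n := 2)]
    have : 2 * 10 ^ 6 * d * ν ^ 2 * T = 2 * 10^6 * (T:ℝ) * (d * ν^2) := by ring
    rw [this]
    nlinarith
  have hb0 : 0 < b := by linarith
  set K : ℝ := Real.log (2*T*(T+1)) + 1 with hK
  have hlog0 : 0 ≤ Real.log (2*T*(T+1)) := Real.log_nonneg (by nlinarith)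
  have hK1 : 1 ≤ K := by linarith
  have c1 : (20:ℝ) ≤ ⌈Real.logb 2 b⌉₊ := by
    refine le_trans ?_ (Nat.le_ceil _)
    rw [Real.le_logb_iff_rpow_le (by norm_num) hb0]
    have : (2:ℝ)^(20:ℝ) = 2^(20:ℕ) := by exact_mod_cast Real.rpow_natCast 2 20
    rw [this]; norm_num; linarith
  have c2 : K ≤ ⌈Real.logb 2 (b^2*T)⌉₊ := by
    refine le_trans ?_ (Nat.le_ceil _)
    have hx : 2*T*(T+1) * Real.exp 1 ≤ b^2*T := by
      have he : Real.exp 1 ≤ 3 := by linarith [Real.exp_one_lt_d9]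
      have hp : (0:ℝ) ≤ 2*T*(T+1) := by positivity
      have h1 : 2*T*(T+1) * Real.exp 1 ≤ 2*T*(T+1)*3 := mul_le_mul_of_nonneg_left he hp
      have h2 : 6 * ((T:ℝ)+1) ≤ b^2 := by nlinarith
      nlinarith
    have e1 : K = Real.log (2*T*(T+1) * Real.exp 1) := by
      rw [Real.log_mul (by positivity) (by positivity), Real.log_exp]
    have h3 : K ≤ Real.log (b^2*T) := by
      rw [e1]; exact Real.log_le_log (by positivity) hx
    refine h3.trans ?_
    rw [Real.logb, le_div_iff₀ (Real.log_pos (by norm_num))]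
    have : Real.log 2 ≤ 1 := by linarith [Real.log_two_lt_d9]
    nlinarith
  have hC20 : 20 * K ≤ (C:ℝ) := by
    rw [hC]; push_cast
    exact mul_le_mul c1 c2 (by linarith) (by positivity)
  have hC0 : (0:ℝ) < C := by linarith
  set L := Real.log (C/δ) with hL
  have hLd : L = Real.log C + Real.log (1/δ) := by
    rw [hL, div_eq_mul_one_div, Real.log_mul hC0.ne' (by positivity)]
  have hld : 0 ≤ Real.log (1/δ) := Real.log_nonneg (by rw [le_div_iff₀ hδ0]; linarith)
  have hlC : 1 ≤ Real.log C := by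
    rw [Real.le_log_iff_exp_le hC0]; linarith [Real.exp_one_lt_d9]
  have hL1 : 1 ≤ L := by linarith
  have hLL : L' ≤ K * L := by
    have : L' = Real.log (2*T*(T+1)) + Real.log (1/δ) := by
      rw [hL', div_eq_mul_one_div, Real.log_mul (by positivity) (by positivity)]
    rw [this, hK]; nlinarith
  have hsν : 1 ≤ √ν := Real.one_le_sqrt.mpr hν
  have hM2 : M ≤ 30 * (d * (√ν + ρ)) := by
    have h8 : √(800*ν) ≤ 29 * √ν := by
      rw [Real.sqrt_mul (by norm_num)]
      apply mul_le_mul_of_nonneg_right _ (by positivity)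
      rw [Real.sqrt_le_left (by norm_num)]; norm_num
    have h9 : (d:ℝ) * √(800*ν) ≤ d * (29 * √ν) := mul_le_mul_of_nonneg_left h8 (by positivity)
    have h10 : 1 ≤ (d:ℝ) * √ν := by nlinarith
    have h11 : 0 ≤ (d:ℝ) * ρ := by positivity
    nlinarith
  set Q := √(ν + ρ^2) with hQ
  have hQ1 : √ν + ρ ≤ 2 * Q := by
    have : √ν ≤ Q := Real.sqrt_le_sqrt (by linarith [sq_nonneg ρ])
    have : ρ ≤ Q := Real.le_sqrt_of_sq_le (by linarith)
    linarith
  have hVL : √(V*L') ≤ K * √(V*L) := by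
    have : √(V*L') ≤ √(K^2 * (V*L)) := by
      apply Real.sqrt_le_sqrt
      have : V * L' ≤ V * (K*L) := mul_le_mul_of_nonneg_left hLL hV
      have h2 : V * L * K ≤ V * L * K^2 := mul_le_mul_of_nonneg_left (le_self_pow₀ hK1 (by norm_num)) (by positivity)
      linarith [mul_comm (V*L) K, mul_comm (V*L) (K^2), mul_left_comm V K L, mul_comm K (V*L)]
    rwa [Real.sqrt_mul (sq_nonneg K) (V*L), Real.sqrt_sq (by linarith)] at this
  have e : √((ν + ρ ^ 2) * V * L) = Q * √(V*L) := by
    rw [mul_assoc, Real.sqrt_mul (by positivity)]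
  rw [e]
  have hU : 0 ≤ C * √(32 * U * L) := by positivity
  set S := √(V*L) with hS
  have hS0 : 0 ≤ S := Real.sqrt_nonneg _
  have p1 : M * √(V*L') ≤ (60 * (d * Q)) * (K * S) := by
    apply mul_le_mul _ hVL (Real.sqrt_nonneg _) (by positivity)
    have := mul_le_mul_of_nonneg_left hQ1 (by positivity : (0:ℝ) ≤ 30 * d)
    linarith
  have p2 : M * L' ≤ (30 * (d * (√ν + ρ))) * (K * L) :=
    (mul_le_mul_of_nonneg_left hLL hM0).trans (mul_le_mul_of_nonneg_right hM2 (by positivity))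
  have q1 : (d * Q * S) * (20 * K) ≤ (d * Q * S) * C := mul_le_mul_of_nonneg_left hC20 (by positivity)
  have q2 : (d * (√ν + ρ) * L) * (20 * K) ≤ (d * (√ν + ρ) * L) * C :=
    mul_le_mul_of_nonneg_left hC20 (by positivity)
  have r1 : 0 ≤ (d * Q * S) * C := by positivity
  have r2 : 0 ≤ (d * (√ν + ρ) * L) * C := by positivity
  linarith


/-- **Lemma B.5: high-probability bound on the deviation term for linear bandits.**
In Algorithm 2 (SCRiBLe-style mirror descent with the lifted `800ν`-normal barrier,
where at each round `s_t` is sampled uniformly from the unit sphere of the orthogonal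
complement of `H_t^{-1/2} e_{d+1}`), with probability at least `1 − δ`,
`∑_{t=1}^T (⟨w̃⁺_t, ℓ⁺_t⟩ − ⟨w⁺_t, ℓ̂⁺_t⟩ + ⟨u⁺, ℓ̂⁺_t − ℓ⁺_t⟩)
  ≤ 161 C d √((ν + ρ²) L̊_T ln(C/δ)) + C √(32 L̄_u ln(C/δ)) + 64 C d (√ν + ρ) ln(C/δ)`,
where `C = ⌈log₂ b⌉ ⌈log₂ (b² T)⌉` with `b = 2·10⁶ d ν² T`. -/
theorem deviation_term_high_probability
    {Ω : Type*} {m0 : MeasurableSpace Ω} (μ : Measure Ω) [IsProbabilityMeasure μ]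
    (F : ℕ → MeasurableSpace Ω) (hFmono : Monotone F) (hFle : ∀ t, F t ≤ m0)
    (d T : ℕ) (hd : 1 ≤ d) (hT : 2 ≤ T) (ν η : ℝ) (hν : 1 ≤ ν) (hη : 0 < η)
    (δ : ℝ) (hδ : δ ∈ Set.Ioo (0 : ℝ) 1)
    (Ωs : Set (Fin d → ℝ)) (hconv : Convex ℝ Ωs) (hcomp : IsCompact Ωs)
    (hint : (interior Ωs).Nonempty)
    (ψ : (Fin d → ℝ) → ℝ) (hψ : IsSCB Ωs ψ ν)
    -- processes
    (ℓv : ℕ → Ω → Fin d → ℝ) (sv wp : ℕ → Ω → Fin (d + 1) → ℝ)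
    (R : ℕ → Ω → Matrix (Fin (d + 1)) (Fin (d + 1)) ℝ)
    (ηv : ℕ → Ω → ℝ) (S : ℕ → Ω → Finset ℕ)
    (κ : ℕ → Ω → Measure (Fin (d + 1) → ℝ))
    -- abbreviations
    (Ψ : (Fin (d + 1) → ℝ) → ℝ) (hΨ : Ψ = liftedBarrier ψ ν)
    (Ωp : Set (Fin (d + 1) → ℝ)) (hΩp : Ωp = liftv '' Ωs)
    (w1 : Fin (d + 1) → ℝ) (hwp1 : ∀ ω, wp 1 ω = w1)
    (H : ℕ → Ω → Matrix (Fin (d + 1)) (Fin (d + 1)) ℝ)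
    (hH : ∀ t ω, H t ω = hess Ψ (wp t ω))
    (elast : Fin (d + 1) → ℝ) (helast : elast = Pi.single (Fin.last d) 1)
    (lp : ℕ → Ω → Fin (d + 1) → ℝ) (hlp : ∀ t ω, lp t ω = Fin.snoc (ℓv t ω) 0)
    (wt : ℕ → Ω → Fin (d + 1) → ℝ)
    (hwt : ∀ t ω, wt t ω = wp t ω + (R t ω)⁻¹.mulVec (sv t ω))
    (lh : ℕ → Ω → Fin (d + 1) → ℝ)
    (hlh : ∀ t ω, lh t ω = ((d : ℝ) * dotp (wt t ω) (lp t ω)) • (R t ω).mulVec (sv t ω))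
    (Ωp' : Set (Fin (d + 1) → ℝ))
    (hΩp' : Ωp' = {x ∈ Ωp | mink Ωp w1 x ≤ 1 - 1 / (T : ℝ)})
    -- adaptive adversary and adaptedness of the algorithm's state
    (hℓmeas : ∀ t i, StronglyMeasurable[F t] fun ω => ℓv t ω i)
    (hwpmeas : ∀ t i, StronglyMeasurable[F t] fun ω => wp t ω i)
    (hsmeas : ∀ t i, StronglyMeasurable[F (t + 1)] fun ω => sv t ω i)
    (hℓbound : ∀ t ∈ Finset.Icc 1 T, ∀ ω, ∀ w ∈ Ωs, |dotp w (ℓv t ω)| ≤ 1)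
    -- Algorithm 2
    (hinit : w1 ∈ Ωp ∧ ∀ y ∈ Ωp, Ψ w1 ≤ Ψ y)
    (hR : ∀ t ∈ Finset.Icc 1 (T + 1), ∀ ω,
      (R t ω).PosDef ∧ (R t ω).IsSymm ∧ R t ω * R t ω = H t ω)
    -- s_t is drawn uniformly from the sphere of the hyperplane orthogonal to
    -- H_t^{-1/2} e_{d+1}, conditionally on the past
    (hκprob : ∀ t ω, IsProbabilityMeasure (κ t ω))
    (hκsupp : ∀ t ∈ Finset.Icc 1 T, ∀ ω, ∀ᵐ x ∂(κ t ω),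
      dotp x x = 1 ∧ dotp x ((R t ω)⁻¹.mulVec elast) = 0)
    (hκunif : ∀ t ∈ Finset.Icc 1 T, ∀ ω,
      ∀ O : Matrix (Fin (d + 1)) (Fin (d + 1)) ℝ, Oᵀ * O = 1 →
        O.mulVec ((R t ω)⁻¹.mulVec elast) = (R t ω)⁻¹.mulVec elast →
        (κ t ω).map O.mulVec = κ t ω)
    (hκlaw : ∀ t ∈ Finset.Icc 1 T, ∀ g : (Fin (d + 1) → ℝ) → ℝ, Measurable g →
      (∀ x, |g x| ≤ 1) →
      μ[fun ω => g (sv t ω) | F t] =ᵐ[μ] fun ω => ∫ x, g x ∂(κ t ω))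
    (hsval : ∀ t ∈ Finset.Icc 1 T, ∀ ω,
      dotp (sv t ω) (sv t ω) = 1 ∧ dotp (sv t ω) ((R t ω)⁻¹.mulVec elast) = 0)
    (hupd : ∀ t ∈ Finset.Icc 1 T, ∀ ω, wp (t + 1) ω ∈ Ωp' ∧ ∀ y ∈ Ωp',
      dotp (wp (t + 1) ω) (lh t ω) + (1 / ηv t ω) * breg Ψ (wp (t + 1) ω) (wp t ω)
        ≤ dotp y (lh t ω) + (1 / ηv t ω) * breg Ψ y (wp t ω))
    (hη1 : ∀ ω, ηv 1 ω = η) (hS1 : ∀ ω, S 1 ω = {1})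
    (hsch : ∀ t ∈ Finset.Icc 1 T, ∀ ω,
      ((∃ p : Fin (d + 1) → ℝ,
          0 < dotp p ((H (t + 1) ω - ∑ τ ∈ S t ω, H τ ω).mulVec p)) →
        S (t + 1) ω = insert (t + 1) (S t ω) ∧
        ηv (t + 1) ω = Real.exp (1 / (100 * d * Real.log (ν * T))) * ηv t ω) ∧
      (¬ (∃ p : Fin (d + 1) → ℝ,
          0 < dotp p ((H (t + 1) ω - ∑ τ ∈ S t ω, H τ ω).mulVec p)) →
        S (t + 1) ω = S t ω ∧ ηv (t + 1) ω = ηv t ω))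
    -- comparator
    (ustar : Fin d → ℝ) (hustar : ustar ∈ Ωs)
    (up : Fin (d + 1) → ℝ)
    (hup : up = (1 - 1 / (T : ℝ)) • liftv ustar + (1 / (T : ℝ)) • w1)
    (uvec : Fin d → ℝ) (huvec : uvec = fun i => up i.castSucc)
    (ρm : Ω → ℝ)
    (hρm : ∀ ω, ρm ω = (Finset.Icc 1 T).sup'
      (Finset.nonempty_Icc.mpr (by omega)) fun t => qnorm (H t ω) up)
    (b : ℝ) (hb : b = 2 * 10 ^ 6 * d * ν ^ 2 * T)
    (C : ℕ) (hC : C = ⌈Real.logb 2 b⌉₊ * ⌈Real.logb 2 (b ^ 2 * T)⌉₊) :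
    ENNReal.ofReal (1 - δ) ≤
      μ {ω | ∑ t ∈ Finset.Icc 1 T,
          (dotp (wt t ω) (lp t ω) - dotp (wp t ω) (lh t ω) +
            dotp up (lh t ω - lp t ω))
        ≤ 161 * C * d * Real.sqrt ((ν + (ρm ω) ^ 2) *
              (∑ t ∈ Finset.Icc 1 T,
                (μ[fun ω' => |dotp (wt t ω') (lp t ω')| | F t]) ω) *
              Real.log (C / δ))
          + C * Real.sqrt (32 * (∑ t ∈ Finset.Icc 1 T, |dotp uvec (ℓv t ω)|) *
              Real.log (C / δ))
          + 64 * C * d * (Real.sqrt ν + ρm ω) * Real.log (C / δ)} := by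
  subst hΨ helast hΩp hΩp' huvec
  have hcl : IsClosed Ωs := hcomp.isClosed
  have hT0 : (0:ℝ) < T := by positivity
  have hT1 : 1 / (T:ℝ) ≤ 1 := by
    rw [div_le_one hT0]; exact_mod_cast (by omega : 1 ≤ T)
  have huK : up ∈ liftv '' Ωs := by
    obtain ⟨w, hw, hww⟩ := hinit.1
    refine ⟨(1 - 1 / (T : ℝ)) • ustar + (1 / (T : ℝ)) • w,
      hconv hustar hw (by linarith) (by positivity) (by ring), ?_⟩
    rw [hup, ← hww]
    funext i
    refine Fin.lastCases ?_ (fun i => ?_) i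
    · simp [liftv]
    · simp [liftv]
  have hwK : ∀ t ∈ Finset.Icc 1 T, ∀ ω, wp t ω ∈ liftv '' Ωs := by
    intro t ht ω
    rw [Finset.mem_Icc] at ht
    rcases Nat.eq_or_lt_of_le ht.1 with h | h
    · rw [← h, hwp1]; exact hinit.1
    · have := (hupd (t-1) (Finset.mem_Icc.mpr ⟨by omega, by omega⟩) ω).1
      rw [Nat.sub_add_cancel (by omega)] at this
      exact this.1
  set q : ℕ → Ω → ℝ := fun t ω => if t = 0 then 0 else qnorm (H t ω) up with hq
  have hq0 : ∀ t ω, 0 ≤ q t ω := by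
    intro t ω; simp only [hq]; split_ifs
    · exact le_rfl
    · exact Real.sqrt_nonneg _
  have hqm : ∀ t, Measurable[F t] (q t) := by
    intro t
    simp only [hq]; split_ifs
    · exact measurable_const
    · apply aux_qnorm_meas
      intro i j
      simp only [hH]
      exact aux_hess_meas (F t) _ _ (fun i => (hwpmeas t i).measurable) i j
  set r : ℕ → Ω → ℝ := fun t ω => (Finset.range (t+1)).sup' ⟨0, by simp⟩ fun s => q s ω with hr
  have hqr : ∀ s t ω, s ≤ t → q s ω ≤ r t ω := fun s t ω hst =>
    Finset.le_sup' (fun s => q s ω) (Finset.mem_range.mpr (by omega))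
  have hrmono : ∀ t ω, r t ω ≤ r (t+1) ω := by
    intro t ω
    refine Finset.sup'_le _ _ fun s hs => ?_
    rw [Finset.mem_range] at hs
    exact hqr s (t+1) ω (by omega)
  have hr0 : ∀ t ω, 0 ≤ r t ω := fun t ω => (hq0 t ω).trans (hqr t t ω le_rfl)
  have hrm : ∀ t, Measurable[F t] (r t) := by
    intro t
    have := @Finset.measurable_sup' ℝ _ Ω (F t) _ _ ℕ (Finset.range (t+1)) ⟨0, by simp⟩ q
      (fun s hs => (hqm s).mono (hFmono (by rw [Finset.mem_range] at hs; omega)) le_rfl)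
    convert this using 1
    funext ω
    exact (Finset.sup'_apply (C := fun _ : Ω => ℝ) _ q ω).symm
  have hqρ : ∀ t ∈ Finset.Icc 1 T, ∀ ω, qnorm (H t ω) up ≤ ρm ω := by
    intro t ht ω
    rw [hρm]
    exact Finset.le_sup' (fun t => qnorm (H t ω) up) ht
  have hρ0 : ∀ ω, 0 ≤ ρm ω := fun ω =>
    (Real.sqrt_nonneg _).trans (hqρ 1 (Finset.mem_Icc.mpr ⟨le_rfl, by omega⟩) ω)
  have hrT : ∀ ω, r T ω ≤ ρm ω := by
    intro ω
    refine Finset.sup'_le _ _ fun s hs => ?_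
    rw [Finset.mem_range] at hs
    by_cases h : s = 0
    · simpa [hq, h] using hρ0 ω
    · simpa [hq, h] using hqρ s (Finset.mem_Icc.mpr ⟨by omega, by omega⟩) ω
  set M : ℕ → Ω → ℝ := fun t ω => 1 + d * (√(800*ν) + r t ω) with hM
  have hM0 : ∀ t ω, 0 ≤ M t ω := fun t ω => by
    have := hr0 t ω; simp only [hM]; positivity
  have hMmono : ∀ t ω, M t ω ≤ M (t+1) ω := fun t ω => by
    have := mul_le_mul_of_nonneg_left (hrmono t ω) (Nat.cast_nonneg d : (0:ℝ) ≤ d)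
    simp only [hM]; linarith
  have hMm : ∀ t, Measurable[F t] (M t) := fun t =>
    measurable_const.add (measurable_const.mul (measurable_const.add (hrm t)))
  have hproc : ∀ t : ℕ, ∃ Y y : Ω → ℝ, t ∈ Finset.Icc 1 T → (Measurable[F (t+1)] Y ∧ (∀ ω, |Y ω| ≤ 1) ∧
      Measurable[F (t+1)] (fun ω => |dotp (wt t ω) (lp t ω)|) ∧ (∀ ω, |dotp (wt t ω) (lp t ω)| ≤ 1) ∧
      (∀ ω, Y ω ^ 2 ≤ |dotp (wt t ω) (lp t ω)|) ∧ Measurable[F t] y ∧ (∀ ω, |y ω| ≤ 1) ∧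
      μ[Y|F t] =ᵐ[μ] y ∧
      ∀ ω, dotp (wt t ω) (lp t ω) - dotp (wp t ω) (lh t ω) + dotp up (lh t ω - lp t ω)
        = M t ω * (Y ω - y ω)) := by
    intro t
    by_cases ht : t ∈ Finset.Icc 1 T
    swap
    · exact ⟨0, 0, fun h => absurd h ht⟩
    have ht' := Finset.mem_Icc.mp ht
    obtain ⟨Y, y, h⟩ := aux_proc (F t) (F (t+1)) μ (hFmono (Nat.le_succ t)) (hFle _) hd Ωs hconv hcl hint
      ψ ν hψ (wp t) (sv t) (hwK t ht) (R t)
      (fun ω => by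
        have := hR t (Finset.mem_Icc.mpr ⟨ht'.1, by omega⟩) ω
        rwa [hH] at this)
      (ℓv t) (hℓbound t ht) up huK (κ t) (hκprob t) (hκsupp t ht) (hκunif t ht) (hκlaw t ht)
      (hsval t ht) (fun i => (hℓmeas t i).measurable) (fun i => (hwpmeas t i).measurable)
      (fun i => (hsmeas t i).measurable) (lp t) (wt t) (lh t) (hlp t) (hwt t) (hlh t) (M t) (hMm t)
      (fun ω => by
        have h1 := hqr t t ω le_rfl
        have h2 : q t ω = qnorm (hess (liftedBarrier ψ ν) (wp t ω)) up := by
          simp only [hq, hH]; rw [if_neg (by omega)]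
        rw [h2] at h1
        have := mul_le_mul_of_nonneg_left h1 (Nat.cast_nonneg d : (0:ℝ) ≤ d)
        simp only [hM]; linarith)
    exact ⟨Y, y, fun _ => h⟩
  choose Y y hYy using hproc
  set a : ℕ → Ω → ℝ := fun t ω => |dotp (wt t ω) (lp t ω)| with ha
  set v : ℕ → Ω → ℝ := fun t ω => max 0 (min 1 ((μ[a t|F t]) ω)) with hv
  have ham : ∀ t ∈ Finset.Icc 1 T, Measurable (a t) := fun t ht =>
    (hYy t ht).2.2.1.mono (hFle _) le_rfl
  have hvb : ∀ t ω, 0 ≤ v t ω ∧ v t ω ≤ 1 := fun t ω =>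
    ⟨le_max_left _ _, max_le zero_le_one (min_le_left _ _)⟩
  have hvm : ∀ t, Measurable[F t] (v t) := fun t =>
    measurable_const.max (measurable_const.min stronglyMeasurable_condExp.measurable)
  have hai : ∀ t ∈ Finset.Icc 1 T, Integrable (a t) μ := fun t ht =>
    aux_int_bdd μ (a t) (ham t ht) 1 (fun ω => by
      simp only [ha, abs_abs]; exact (hYy t ht).2.2.2.1 ω)
  have hvae : ∀ t ∈ Finset.Icc 1 T, μ[a t|F t] =ᵐ[μ] v t := by
    intro t ht
    have h0 : 0 ≤ᵐ[μ] μ[a t|F t] := condExp_nonneg (Filter.Eventually.of_forall fun ω => abs_nonneg _)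
    have h1 : μ[a t|F t] ≤ᵐ[μ] μ[(fun _ => (1:ℝ))|F t] :=
      condExp_mono (hai t ht) (integrable_const _)
        (Filter.Eventually.of_forall fun ω => (hYy t ht).2.2.2.1 ω)
    rw [condExp_const (hFle t)] at h1
    filter_upwards [h0, h1] with ω h0 h1
    simp only [hv]
    rw [min_eq_right h1]
    exact (max_eq_right h0).symm
  have hbad := aux_conc μ F hFmono hFle T hT δ hδ Y a y v (fun t ht => (hYy t ht).1)
    (fun t ht => (hYy t ht).2.1) ham
    (fun t ht ω => by simp only [ha, abs_abs]; exact (hYy t ht).2.2.2.1 ω)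
    (fun t ht => (hYy t ht).2.2.2.2.1) (fun t ht => (hYy t ht).2.2.2.2.2.1)
    (fun t ht => (hYy t ht).2.2.2.2.2.2.1) (fun t _ => hvm t) (fun t _ => hvb t)
    (fun t ht => (hYy t ht).2.2.2.2.2.2.2.1) hvae _ rfl
  have hae : ∀ᵐ ω ∂μ, ∀ t ∈ Finset.Icc 1 T, (μ[a t|F t]) ω = v t ω :=
    (Filter.eventually_all_finset _).mpr hvae
  rw [ENNReal.ofReal_sub _ hδ.1.le, ENNReal.ofReal_one, tsub_le_iff_right]
  set E := {ω | ∑ t ∈ Finset.Icc 1 T,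
          (dotp (wt t ω) (lp t ω) - dotp (wp t ω) (lh t ω) +
            dotp up (lh t ω - lp t ω))
        ≤ 161 * C * d * Real.sqrt ((ν + (ρm ω) ^ 2) *
              (∑ t ∈ Finset.Icc 1 T, (μ[a t | F t]) ω) *
              Real.log (C / δ))
          + C * Real.sqrt (32 * (∑ t ∈ Finset.Icc 1 T,
              |dotp (fun i => up i.castSucc) (ℓv t ω)|) * Real.log (C / δ))
          + 64 * C * d * (Real.sqrt ν + ρm ω) * Real.log (C / δ)} with hE
  have hcompl : μ Eᶜ ≤ ENNReal.ofReal δ := by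
    refine le_trans (measure_mono_ae ?_) hbad
    filter_upwards [hae] with ω hω
    intro hn
    by_contra hgood
    apply hn
    have hgood' := not_not.mp hgood
    have h1 := aux_abel T (fun t => M t ω) (fun t => Y t ω - y t ω) _ (fun t => hM0 t ω)
      (fun t => hMmono t ω) hgood'
    rw [hE, Set.mem_ofPred_eq, Finset.sum_congr rfl hω,
      Finset.sum_congr rfl (fun t ht => (hYy t ht).2.2.2.2.2.2.2.2 ω)]
    refine h1.trans (aux_arith d T hd hT ν δ (ρm ω) _ _ (M T ω) _ hν hδ.1 hδ.2 (hρ0 ω)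
      (Finset.sum_nonneg fun t _ => (hvb t ω).1) (hM0 T ω) ?_ rfl b hb C hC)
    have := mul_le_mul_of_nonneg_left (hrT ω) (Nat.cast_nonneg d : (0:ℝ) ≤ d)
    simp only [hM]; linarith
  calc (1:ENNReal) = μ Set.univ := measure_univ.symm
    _ = μ (E ∪ Eᶜ) := by rw [Set.union_compl_self]
    _ ≤ μ E + μ Eᶜ := measure_union_le _ _
    _ ≤ μ E + ENNReal.ofReal δ := by gcongr
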